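/- Limiting Einstein equation: under the high-frequency setup, for all μ,ν ∈ {0,…,d} and every ψ ∈ C_c^∞(ℝ^(d+1); ℝ) supported in the interior of K: ∫_{ℝ^(d+1)} ψ(x) Ric_μν(g_0)(x) √|det g_0(x)| dx = ∫_{U×S^d} ψ(x) ξ_μ ξ_ν dμ(x,ξ). -/

import Mathlib

noncomputable section

open MeasureTheory Filter Topology
open scoped ENNReal NNReal

abbrev Vec (d : ℕ) := Fin (d + 1) → ℝ
abbrev SymMat (d : ℕ) := Vec d → Matrix (Fin (d + 1)) (Fin (d + 1)) ℝ
abbrev Met (d : ℕ) := SymMat d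
abbrev Phase (d : ℕ) := Vec d × Vec d

/-- Coordinate partial derivative `∂_α`. -/
def pd {d : ℕ} {E : Type*} [NormedAddCommGroup E] [NormedSpace ℝ E]
    (α : Fin (d + 1)) (f : Vec d → E) (x : Vec d) : E :=
  fderiv ℝ f x (Pi.single α 1)

/-- Entries of the pointwise inverse matrix `g^{αβ}`. -/
def ginv {d : ℕ} (g : Met d) (x : Vec d) : Matrix (Fin (d + 1)) (Fin (d + 1)) ℝ := (g x)⁻¹

/-- Minkowski matrix `diag(-1,1,…,1)`. -/
def mink (d : ℕ) : Matrix (Fin (d + 1)) (Fin (d + 1)) ℝ :=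
  Matrix.diagonal (fun α => if α = 0 then (-1 : ℝ) else 1)

/-- A metric on V : smooth entries, symmetric and invertible pointwise on V. -/
def IsMetricOn {d : ℕ} (g : Met d) (V : Set (Vec d)) : Prop :=
  (∀ α β, ContDiffOn ℝ (⊤ : ℕ∞) (fun x => g x α β) V) ∧
  (∀ x ∈ V, (g x).IsSymm) ∧ (∀ x ∈ V, IsUnit (g x).det)

/-- Christoffel symbol `Γ_{αβμ}(g)`. -/
def Christoffel {d : ℕ} (g : Met d) (α β μ : Fin (d + 1)) (x : Vec d) : ℝ :=
  (1 / 2) * (pd α (fun y => g y μ β) x + pd μ (fun y => g y α β) x - pd β (fun y => g y α μ) x)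

/-- Mixed Christoffel symbol `Γ_ρ{}^α{}_μ(g)`. -/
def GammaMix {d : ℕ} (g : Met d) (ρ α μ : Fin (d + 1)) (x : Vec d) : ℝ :=
  ∑ β, ginv g x α β * Christoffel g ρ β μ x

/-- Coordinate formula for the Ricci curvature. -/
def RicciC {d : ℕ} (g : Met d) (μ ν : Fin (d + 1)) (x : Vec d) : ℝ :=
  (∑ α, ∑ β, ginv g x α β * (pd β (Christoffel g μ α ν) x - pd ν (Christoffel g μ α β) x)) +
  ∑ α, ∑ β, ∑ σ, ∑ ρ, ginv g x α β * ginv g x σ ρ *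
    (Christoffel g ν σ α x * Christoffel g μ ρ β x -
      Christoffel g α σ β x * Christoffel g μ ρ ν x)

/-- `H^ρ(g)(∂p)`. -/
def Hgauge {d : ℕ} (g : Met d) (p : SymMat d) (ρ : Fin (d + 1)) (x : Vec d) : ℝ :=
  ∑ σ, ∑ α, ∑ β, ginv g x ρ σ * ginv g x α β *
    (pd β (fun y => p y σ α) x - (1 / 2) * pd σ (fun y => p y α β) x)

/-- Scalar wave operator `Box_g f = g^{αβ} ∂²_{αβ} f − H^α(g)(∂g) ∂_α f`. -/
def BoxOp {d : ℕ} {E : Type*} [NormedAddCommGroup E] [NormedSpace ℝ E]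
    (g : Met d) (f : Vec d → E) (x : Vec d) : E :=
  (∑ α, ∑ β, ginv g x α β • pd α (pd β f) x) - ∑ α, Hgauge g g α x • pd α f x

/-- Fourier transform on `ℝ^n` with the convention `∫ f(x) e^{-i x·ξ} dx`. -/
def ft {n : ℕ} (f : (Fin n → ℝ) → ℂ) (ξ : Fin n → ℝ) : ℂ :=
  ∫ x : Fin n → ℝ, f x * Complex.exp (-Complex.I * (∑ i, x i * ξ i))

/-- Inverse Fourier transform on `ℝ^n`. -/
def ftInv {n : ℕ} (f : (Fin n → ℝ) → ℂ) (x : Fin n → ℝ) : ℂ :=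
  ((((2 * Real.pi) ^ n)⁻¹ : ℝ) : ℂ) *
    ∫ ξ : Fin n → ℝ, f ξ * Complex.exp (Complex.I * (∑ i, x i * ξ i))

/-- Fourier multiplier operator `T_m u = F^{-1}(m · F u)`. -/
def Tm {n : ℕ} (m : (Fin n → ℝ) → ℝ) (u : (Fin n → ℝ) → ℂ) : (Fin n → ℝ) → ℂ :=
  ftInv (fun ξ => (m ξ : ℂ) * ft u ξ)

/-- Pairing `⟨u,v⟩ = ∫ conj(u) v √|det g| dx`. -/
def pairG {d : ℕ} (g : Met d) (u v : Vec d → ℂ) : ℂ :=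
  ∫ x : Vec d, (starRingEnd ℂ) (u x) * v x * ((Real.sqrt |(g x).det| : ℝ) : ℂ)

/-- `m` is smooth away from `0` and positively `0`-homogeneous. -/
def Homog0 {n : ℕ} (m : (Fin n → ℝ) → ℝ) : Prop :=
  ContDiffOn ℝ (⊤ : ℕ∞) m {(0 : Fin n → ℝ)}ᶜ ∧ ∀ s : ℝ, 0 < s → ∀ ξ, m (s • ξ) = m ξ

/-- Integral of a function against a (finite) signed measure. -/
def sInt {X : Type*} [MeasurableSpace X] (μ : MeasureTheory.SignedMeasure X) (f : X → ℝ) : ℝ :=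
  (∫ x, f x ∂μ.toJordanDecomposition.posPart) -
    ∫ x, f x ∂μ.toJordanDecomposition.negPart

/-- Unit sphere `S^d ⊂ ℝ^{d+1}`. -/
def usphere (d : ℕ) : Set (Vec d) := {ξ | ∑ α, ξ α ^ 2 = 1}

/-- Integral against `dμ := g_0^{αρ} g_0^{βσ} ((1/4) dμ_{ρβασ} − (1/8) dμ_{ραβσ})`. -/
def muInt {d : ℕ} (g0 : Met d)
    (μm : Fin (d + 1) → Fin (d + 1) → Fin (d + 1) → Fin (d + 1) →
      MeasureTheory.SignedMeasure (Phase d))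
    (c : Phase d → ℝ) : ℝ :=
  ∑ α, ∑ β, ∑ ρ, ∑ σ,
    ((1 / 4) * sInt (μm ρ β α σ) (fun p => ginv g0 p.1 α ρ * ginv g0 p.1 β σ * c p) -
     (1 / 8) * sInt (μm ρ α β σ) (fun p => ginv g0 p.1 α ρ * ginv g0 p.1 β σ * c p))

/-- `∂_{x^μ}` on phase space. -/
def pdx {d : ℕ} (μ : Fin (d + 1)) (F : Phase d → ℝ) (p : Phase d) : ℝ :=
  fderiv ℝ F p (Pi.single μ 1, 0)

/-- `∂_{ξ_μ}` on phase space. -/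
def pdxi {d : ℕ} (μ : Fin (d + 1)) (F : Phase d → ℝ) (p : Phase d) : ℝ :=
  fderiv ℝ F p (0, Pi.single μ 1)

/-- `g_0^{μν} ξ_μ ξ_ν` as a function on phase space. -/
def Gq {d : ℕ} (g0 : Met d) (p : Phase d) : ℝ := ∑ μ, ∑ ν, ginv g0 p.1 μ ν * p.2 μ * p.2 ν

/-- Poisson bracket `{F,G} = ∂_{ξ_μ}F ∂_{x^μ}G − ∂_{x^μ}F ∂_{ξ_μ}G`. -/
def pbracket {d : ℕ} (F G : Phase d → ℝ) (p : Phase d) : ℝ :=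
  ∑ μ, (pdxi μ F p * pdx μ G p - pdx μ F p * pdxi μ G p)

/-- The `X^p_λ(g)` norm. -/
def XNorm {d : ℕ} (p : ℝ≥0∞) (lam : ℝ) (g : Met d) (f : Vec d → ℂ) : ℝ :=
  lam⁻¹ * (eLpNorm f p volume).toReal +
  (∑ α, (eLpNorm (pd α f) p volume).toReal) +
  lam * (∑ α, ∑ β, (eLpNorm (pd α (pd β f)) p volume).toReal) +
  (eLpNorm (BoxOp g f) p volume).toReal

/-- Null form `𝔔_0^{(g)}` (complex-valued). -/
def Q0C {d : ℕ} (g : Met d) (φ ψ : Vec d → ℂ) (x : Vec d) : ℂ :=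
  ∑ α, ∑ β, ((ginv g x α β : ℝ) : ℂ) * pd α φ x * pd β ψ x

/-- Null form `𝔔_{μν}` (complex-valued). -/
def QmnC {d : ℕ} (μ ν : Fin (d + 1)) (φ ψ : Vec d → ℂ) (x : Vec d) : ℂ :=
  pd μ φ x * pd ν ψ x - pd ν φ x * pd μ ψ x

/-- Null form `𝔔_0^{(g)}` (real-valued). -/
def Q0R {d : ℕ} (g : Met d) (φ ψ : Vec d → ℝ) (x : Vec d) : ℝ :=
  ∑ α, ∑ β, ginv g x α β * pd α φ x * pd β ψ x

/-- Null form `𝔔_{μν}` (real-valued). -/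
def QmnR {d : ℕ} (μ ν : Fin (d + 1)) (φ ψ : Vec d → ℝ) (x : Vec d) : ℝ :=
  pd μ φ x * pd ν ψ x - pd ν φ x * pd μ ψ x

/-- The quadratic form `B_{μν}(g)(∂p, ∂q)` (symmetrizations written out). -/
def Bq {d : ℕ} (g : Met d) (p q : SymMat d) (μ ν : Fin (d + 1)) (x : Vec d) : ℝ :=
  ∑ α, ∑ β, ∑ σ, ∑ ρ, ginv g x α β * ginv g x σ ρ *
    ((pd μ (fun y => p y β ρ) x * pd σ (fun y => q y ν α) x +
      pd ν (fun y => p y β ρ) x * pd σ (fun y => q y μ α) x) -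
     (1 / 4) * (pd μ (fun y => p y β ρ) x * pd ν (fun y => q y α σ) x +
                pd ν (fun y => p y β ρ) x * pd μ (fun y => q y α σ) x) +
     pd σ (fun y => p y ν α) x * pd ρ (fun y => q y μ β) x -
     pd α (fun y => p y ν σ) x * pd ρ (fun y => q y μ β) x)

/-- `D_μ^{ασ}(g_0)`. -/
def Dcoef {d : ℕ} (g0 : Met d) (μ α σ : Fin (d + 1)) (x : Vec d) : ℝ :=
  ∑ β, ∑ ρ, ginv g0 x α β * ginv g0 x σ ρ *
    (2 * pd ρ (fun y => g0 y β μ) x - pd μ (fun y => g0 y β ρ) x)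

/-- `L_{μν}(g_0)(∂h)`. -/
def Lq {d : ℕ} (g0 : Met d) (h : SymMat d) (μ ν : Fin (d + 1)) (x : Vec d) : ℝ :=
  2 * (∑ σ, ∑ ρ, ∑ α, ginv g0 x σ ρ *
        (GammaMix g0 ρ α μ x * pd σ (fun y => h y ν α) x +
         GammaMix g0 ρ α ν x * pd σ (fun y => h y μ α) x)) +
  (1 / 2) * (∑ α, ∑ σ, (Dcoef g0 μ α σ x * pd ν (fun y => h y α σ) x +
                        Dcoef g0 ν α σ x * pd μ (fun y => h y α σ) x))

/-- `Q_{μν}(g_0)(∂h, ∂h)`. -/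
def Qq {d : ℕ} (g0 : Met d) (h : SymMat d) (μ ν : Fin (d + 1)) (x : Vec d) : ℝ :=
  (∑ α, ∑ β, ginv g0 x α β * Q0R g0 (fun y => h y ν α) (fun y => h y μ β) x) +
  ∑ α, ∑ β, ∑ σ, ∑ ρ, ginv g0 x α β * ginv g0 x σ ρ *
    ((1 / 2) * (QmnR β μ (fun y => h y σ ρ) (fun y => h y ν α) x +
                QmnR β ν (fun y => h y σ ρ) (fun y => h y μ α) x) +
     (QmnR μ σ (fun y => h y β ρ) (fun y => h y ν α) x +
      QmnR ν σ (fun y => h y β ρ) (fun y => h y μ α) x) -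
     QmnR α ρ (fun y => h y ν σ) (fun y => h y μ β) x)

/-- `P_{μν}(g_0)(∂h, ∂h)`. -/
def Pq {d : ℕ} (g0 : Met d) (h : SymMat d) (μ ν : Fin (d + 1)) (x : Vec d) : ℝ :=
  (1 / 4) * (∑ α, ∑ α', ginv g0 x α α' * pd μ (fun y => h y α α') x) *
            (∑ β, ∑ β', ginv g0 x β β' * pd ν (fun y => h y β β') x) -
  (1 / 2) * ∑ α, ∑ α', ∑ β, ∑ β', ginv g0 x α α' * pd μ (fun y => h y α β) x *
            ginv g0 x β β' * pd ν (fun y => h y α' β') x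

/-- Euclidean norm on `ℝ^n`. -/
def enormV {n : ℕ} (ξ : Fin n → ℝ) : ℝ := Real.sqrt (∑ i, ξ i ^ 2)

/-- The angle quantity `Ξ_{ι1 ι2}(θ,η)`. -/
def XiAng (ι1 ι2 : ℝ) (θ η : Fin 3 → ℝ) : ℝ :=
  Real.sqrt (2 * (enormV θ * enormV η - ι1 * ι2 * ∑ i, θ i * η i) / (enormV θ * enormV η))

/-- The phase `Φ_{ι ι1 ι2}(ξ,η)`. -/
def PhiPh (ι ι1 ι2 : ℝ) (ξ η : Fin 3 → ℝ) : ℝ :=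
  ι * enormV ξ - ι1 * enormV (ξ - η) - ι2 * enormV η

/-- Littlewood–Paley projection on `ℝ³` built from `ψLP`. -/
def LPProj (ψLP : (Fin 3 → ℝ) → ℝ) (k : ℤ) (f : (Fin 3 → ℝ) → ℂ) : (Fin 3 → ℝ) → ℂ :=
  ftInv (fun ξ => (ψLP ((2 : ℝ) ^ (-k) • ξ) : ℂ) * ft f ξ)

/-- A standard Littlewood–Paley bump. -/
def GoodLP (ψLP : (Fin 3 → ℝ) → ℝ) : Prop :=
  ContDiff ℝ (⊤ : ℕ∞) ψLP ∧ (∀ ξ, ψLP ξ ∈ Set.Icc (0 : ℝ) 1) ∧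
  (∀ ξ ζ, enormV ξ = enormV ζ → ψLP ξ = ψLP ζ) ∧
  (Function.support ψLP ⊆ {ξ | 1 / 2 ≤ enormV ξ ∧ enormV ξ ≤ 2}) ∧
  (∀ ξ : Fin 3 → ℝ, ξ ≠ 0 → ∑' k : ℤ, ψLP ((2 : ℝ) ^ (-k) • ξ) = 1)

/-- Admissible symbols of Ionescu–Pausader type. -/
def AdmSymbol (m : (Fin 3 → ℝ) → (Fin 3 → ℝ) → ℝ) : Prop :=
  (∃ i j : Fin 3, ∀ θ η, m θ η = (θ i * η j - θ j * η i) / (enormV θ * enormV η)) ∨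
  (∃ j : Fin 3, ∀ θ η, m θ η = η j / enormV η - θ j / enormV θ)

/-- Spatial part of a spacetime point. -/
def spat (x : Vec 3) : Fin 3 → ℝ := fun i => x i.succ

/-- Reassemble a spacetime point from its time and space parts. -/
def glue (t : ℝ) (y : Fin 3 → ℝ) : Vec 3 := Fin.cons t y

/-- Spatial Littlewood–Paley projection on `ℝ^{1+3}`. -/
def LPsp (ψLP : (Fin 3 → ℝ) → ℝ) (k : ℤ) (u : Vec 3 → ℂ) (x : Vec 3) : ℂ :=
  ftInv (fun ξ => (ψLP ((2 : ℝ) ^ (-k) • ξ) : ℂ) * ft (fun y => u (glue (x 0) y)) ξ) (spat x)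

/-- Minkowski wave operator on `ℝ^{1+3}`. -/
def BoxMink (u : Vec 3 → ℂ) (x : Vec 3) : ℂ :=
  - pd 0 (pd 0 u) x + ∑ i : Fin 3, pd i.succ (pd i.succ u) x

/-- Flat pairing `⟨u,v⟩ = ∫ conj(u) v`. -/
def pairF (u v : Vec 3 → ℂ) : ℂ := ∫ x : Vec 3, (starRingEnd ℂ) (u x) * v x

/-- `Σ_α ‖∂_α φ‖_{L^p}`. -/
def dNorm (p : ℝ≥0∞) (φ : Vec 3 → ℂ) : ℝ := ∑ α, (eLpNorm (pd α φ) p volume).toReal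

/-- Covector `dt − 𝔞_i dx^i`. -/
def cov1 (af : Fin 3 → Vec 3 → ℝ) (x : Vec 3) : Fin (3 + 1) → ℝ :=
  Fin.cons 1 (fun i => - af i x)

/-- Covector `dx^i + 𝔟^i dt + 𝔅^i_j dx^j`. -/
def cov2 (bf : Fin 3 → Vec 3 → ℝ) (Bf : Fin 3 → Fin 3 → Vec 3 → ℝ) (i : Fin 3) (x : Vec 3) :
    Fin (3 + 1) → ℝ :=
  Fin.cons (bf i x) (fun j => (if j = i then (1 : ℝ) else 0) + Bf i j x)

/-- Matrix of the quadratic form `−𝔑 (dt − 𝔞_i dx^i)² + Σ_i 𝔠_i (dx^i + 𝔟^i dt + 𝔅^i_j dx^j)²`. -/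
def met4 (Nf : Vec 3 → ℝ) (af bf cf : Fin 3 → Vec 3 → ℝ) (Bf : Fin 3 → Fin 3 → Vec 3 → ℝ) :
    Met 3 :=
  fun x => Matrix.of fun α β =>
    - Nf x * cov1 af x α * cov1 af x β + ∑ i, cf i x * cov2 bf Bf i x α * cov2 bf Bf i x β


namespace LimitingEinstein

section Algebra

variable {ι : Type*} [Fintype ι]

lemma sum_comm_left (F : ι → ι → ι → ι → ℝ) :
    ∑ a, ∑ b, ∑ c, ∑ d, F a b c d = ∑ a, ∑ b, ∑ c, ∑ d, F b a c d := Finset.sum_comm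

lemma sum_comm_mid (F : ι → ι → ι → ι → ℝ) :
    ∑ a, ∑ b, ∑ c, ∑ d, F a b c d = ∑ a, ∑ b, ∑ c, ∑ d, F a c b d :=
  Finset.sum_congr rfl fun _ _ => Finset.sum_comm

lemma sum_comm_right (F : ι → ι → ι → ι → ℝ) :
    ∑ a, ∑ b, ∑ c, ∑ d, F a b c d = ∑ a, ∑ b, ∑ c, ∑ d, F a b d c :=
  Finset.sum_congr rfl fun _ _ => Finset.sum_congr rfl fun _ _ => Finset.sum_comm

lemma sum_comm_pairs (F : ι → ι → ι → ι → ℝ) :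
    ∑ a, ∑ b, ∑ c, ∑ d, F a b c d = ∑ a, ∑ b, ∑ c, ∑ d, F c d a b := by
  rw [sum_comm_mid, sum_comm_left, sum_comm_right, sum_comm_mid]

lemma sum_congr₄ {F F' : ι → ι → ι → ι → ℝ} (h : ∀ a b c d, F a b c d = F' a b c d) :
    ∑ a, ∑ b, ∑ c, ∑ d, F a b c d = ∑ a, ∑ b, ∑ c, ∑ d, F' a b c d := by
  simp only [h]

variable (G : ι → ι → ℝ) (D : ι → ι → ι → ℝ)

/-- Christoffel combination of a first-derivative array `D a i j = ∂_a h_ij`. -/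
def chr (a b c : ι) : ℝ := (1 / 2) * (D a c b + D c a b - D b a c)

/-- Derivative of the trace, with frozen inverse metric `G`. -/
def trD (s : ι) : ℝ := ∑ a, ∑ b, G a b * D s a b

/-- Divergence, with frozen inverse metric `G`. -/
def divD (s : ι) : ℝ := ∑ a, ∑ b, G a b * D b s a

/-- Wave gauge defect, with frozen inverse metric `G`. -/
def gaugeD (s : ι) : ℝ := ∑ a, ∑ b, G a b * (D b s a - (1 / 2) * D s a b)

/-- The null form `G^{ab} ∂_a h_ij ∂_b h_kl`. -/
def nullD (i j k l : ι) : ℝ := ∑ a, ∑ b, G a b * (D a i j * D b k l)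

/-- The null form `∂_a h_ij ∂_b h_kl - ∂_b h_ij ∂_a h_kl`. -/
def commD (a b i j k l : ι) : ℝ := D a i j * D b k l - D b i j * D a k l

/-- The full contraction `∂_m h^{ij} ∂_n h_ij`. -/
def sqD (m n : ι) : ℝ := ∑ a, ∑ b, ∑ r, ∑ s, G a r * G b s * (D m r b * D n a s)

/-- Quadratic part of the Ricci tensor, after integrating by parts the second-order part. -/
def quadD (m n : ι) : ℝ :=
  (∑ a, ∑ b, ∑ s, ∑ r, G a s * G b r *
    (D b s r * chr D m a n - D n s r * chr D m a b)) +
  ∑ a, ∑ b, ∑ s, ∑ r, G a b * G s r * (chr D n s a * chr D m r b - chr D a s b * chr D m r n)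

lemma divD_eq (s : ι) : divD G D s = gaugeD G D s + (1 / 2) * trD G D s := by
  simp only [divD, gaugeD, trD, Finset.mul_sum, ← Finset.sum_add_distrib]
  refine Finset.sum_congr rfl fun a _ => Finset.sum_congr rfl fun b _ => by ring

lemma trD_mul_divD (m n : ι) :
    trD G D m * divD G D n = ∑ a, ∑ b, ∑ i, ∑ j, G a b * G i j * (D m i j * D b n a) := by
  simp only [trD, divD, Finset.sum_mul, Finset.mul_sum]
  exact sum_congr₄ fun a b i j => by ring

lemma sum_trD_mul (m n : ι) :
    ∑ a, ∑ b, G a b * (trD G D b * D m n a) =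
      (∑ a, ∑ b, ∑ i, ∑ j, G a b * G i j * commD D b m i j n a) + trD G D m * divD G D n := by
  rw [trD_mul_divD]
  simp only [trD, commD, Finset.sum_mul, Finset.mul_sum, ← Finset.sum_add_distrib]
  exact sum_congr₄ fun a b i j => by ring

lemma sum_trD_mul_null (Gs : ∀ a b, G a b = G b a) (m n : ι) :
    ∑ a, ∑ b, G a b * (trD G D b * D a m n) = ∑ i, ∑ j, G i j * nullD G D i j m n := by
  simp only [trD, nullD, Finset.sum_mul, Finset.mul_sum]
  rw [sum_comm_pairs, sum_comm_right]
  exact sum_congr₄ fun a b i j => by rw [Gs j i]; ring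

lemma divergence_term (Gs : ∀ a b, G a b = G b a) (m n : ι) :
    ∑ a, ∑ b, ∑ s, ∑ r, G a s * G b r * (D b s r * chr D m a n) =
      ∑ a, ∑ b, G a b * (divD G D b * chr D m a n) := by
  simp only [divD, Finset.sum_mul, Finset.mul_sum]
  rw [sum_comm_mid]
  rw [sum_comm_right]
  exact sum_congr₄ fun a b i j => by rw [Gs j i]; ring

lemma divergence_term_eq (Gs : ∀ a b, G a b = G b a) (m n : ι) :
    ∑ a, ∑ b, G a b * (divD G D b * chr D m a n) =
      (∑ a, ∑ b, G a b * (gaugeD G D b * chr D m a n)) +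
      (1 / 4) * ((∑ a, ∑ b, ∑ i, ∑ j, G a b * G i j * commD D b m i j n a) +
        (∑ a, ∑ b, ∑ i, ∑ j, G a b * G i j * commD D b n i j m a) +
        trD G D m * gaugeD G D n + trD G D n * gaugeD G D m + trD G D m * trD G D n -
        ∑ i, ∑ j, G i j * nullD G D i j m n) := by
  have h : ∑ a, ∑ b, G a b * (divD G D b * chr D m a n) =
      (∑ a, ∑ b, G a b * (gaugeD G D b * chr D m a n)) +
      (1 / 4) * ((∑ a, ∑ b, G a b * (trD G D b * D m n a)) +
        (∑ a, ∑ b, G a b * (trD G D b * D n m a)) -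
        ∑ a, ∑ b, G a b * (trD G D b * D a m n)) := by
    simp only [Finset.mul_sum, ← Finset.sum_add_distrib, ← Finset.sum_sub_distrib]
    refine Finset.sum_congr rfl fun a _ => Finset.sum_congr rfl fun b _ => ?_
    rw [divD_eq]; simp only [chr]; ring
  rw [h, sum_trD_mul, sum_trD_mul, sum_trD_mul_null G D Gs, divD_eq, divD_eq]
  ring

lemma derivative_term_eq (Gs : ∀ a b, G a b = G b a) (Ds : ∀ a i j, D a i j = D a j i) (m n : ι) :
    ∑ a, ∑ b, ∑ s, ∑ r, G a s * G b r * (D n s r * chr D m a b) =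
      (1 / 2) * sqD G D m n := by
  have h1 : ∑ a, ∑ b, ∑ s, ∑ r, G a s * G b r * (D n s r * D b m a) =
      ∑ a, ∑ b, ∑ s, ∑ r, G a s * G b r * (D n s r * D a m b) := by
    rw [sum_comm_left, sum_comm_right]
    exact sum_congr₄ fun a b s r => by rw [Ds n r s]; ring
  have h2 : ∑ a, ∑ b, ∑ s, ∑ r, G a s * G b r * (D n s r * chr D m a b) =
      (1 / 2) * ((∑ a, ∑ b, ∑ s, ∑ r, G a s * G b r * (D n s r * D m b a)) +
      (∑ a, ∑ b, ∑ s, ∑ r, G a s * G b r * (D n s r * D b m a)) -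
      ∑ a, ∑ b, ∑ s, ∑ r, G a s * G b r * (D n s r * D a m b)) := by
    simp only [Finset.mul_sum, ← Finset.sum_add_distrib, ← Finset.sum_sub_distrib]
    exact sum_congr₄ fun a b s r => by simp only [chr]; ring
  rw [h2, h1, add_sub_cancel_right, sqD]
  congr 1
  rw [sum_comm_mid, sum_comm_left, sum_comm_mid]
  exact sum_congr₄ fun a b s r => by rw [Gs s a, Ds m s b]; ring

lemma divD_mul_divD (Gs : ∀ a b, G a b = G b a) (m n : ι) :
    divD G D n * divD G D m = ∑ a, ∑ b, ∑ s, ∑ r, G a b * G s r * (D r n s * D a m b) := by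
  simp only [divD, Finset.sum_mul, Finset.mul_sum]
  rw [sum_comm_left]
  exact sum_congr₄ fun a b s r => by rw [Gs b a]; ring

lemma sum_pairs_eq_zero (Ds : ∀ a i j, D a i j = D a j i) (n : ι) (E : ι → ι → ℝ)
    (hE : ∀ i j, E i j = - E j i) :
    ∑ a, ∑ b, ∑ s, ∑ r, G a b * G s r * (D n a s * E b r) = 0 := by
  have h : ∑ a, ∑ b, ∑ s, ∑ r, G a b * G s r * (D n a s * E b r) =
      - ∑ a, ∑ b, ∑ s, ∑ r, G a b * G s r * (D n a s * E b r) := by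
    refine (sum_comm_pairs _).trans ?_
    simp only [← Finset.sum_neg_distrib]
    exact sum_congr₄ fun a b s r => by rw [Ds n s a, hE r b]; ring
  linarith

lemma christoffel_sq_eq (Gs : ∀ a b, G a b = G b a) (Ds : ∀ a i j, D a i j = D a j i) (m n : ι) :
    ∑ a, ∑ b, ∑ s, ∑ r, G a b * G s r * (chr D n s a * chr D m r b) =
      (1 / 4) * sqD G D m n + (1 / 2) * (∑ s, ∑ r, G s r * nullD G D n s m r)
      - (1 / 2) * ((∑ a, ∑ b, ∑ s, ∑ r, G a b * G s r * commD D a r n s m b) +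
        divD G D n * divD G D m) := by
  have hsq : ∑ a, ∑ b, ∑ s, ∑ r, G a b * G s r * (D n a s * D m b r) = sqD G D m n := by
    rw [sqD, sum_comm_mid, sum_comm_right, sum_comm_mid, sum_comm_right]
    exact sum_congr₄ fun a b s r => by rw [Gs r b, Ds m s b]; ring
  have hz1 := sum_pairs_eq_zero G D Ds n (fun i j => D i m j - D j m i) (fun i j => by ring)
  have hz2 := sum_pairs_eq_zero (fun i j => G j i) D Ds m (fun i j => D i n j - D j n i)
    (fun i j => by ring)
  rw [sum_comm_left, sum_comm_right] at hz2
  have hn : ∑ a, ∑ b, ∑ s, ∑ r, G a b * G s r * (D a n s * D b m r) =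
      ∑ s, ∑ r, G s r * nullD G D n s m r := by
    simp only [nullD, Finset.mul_sum]
    rw [sum_comm_pairs]
    exact sum_congr₄ fun a b s r => by ring
  have hn' : ∑ a, ∑ b, ∑ s, ∑ r, G a b * G s r * (D s n a * D r m b) =
      ∑ s, ∑ r, G s r * nullD G D n s m r := by
    rw [← hn, sum_comm_pairs]
    exact sum_congr₄ fun a b s r => by ring
  have hc : ∑ a, ∑ b, ∑ s, ∑ r, G a b * G s r * (D a n s * D r m b) =
      (∑ a, ∑ b, ∑ s, ∑ r, G a b * G s r * commD D a r n s m b) + divD G D n * divD G D m := by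
    rw [divD_mul_divD G D Gs]
    simp only [← Finset.sum_add_distrib]
    exact sum_congr₄ fun a b s r => by simp only [commD]; ring
  have hc' : ∑ a, ∑ b, ∑ s, ∑ r, G a b * G s r * (D s n a * D b m r) =
      (∑ a, ∑ b, ∑ s, ∑ r, G a b * G s r * commD D a r n s m b) + divD G D n * divD G D m := by
    rw [← hc, sum_comm_pairs]
    exact sum_congr₄ fun a b s r => by ring
  have h : ∑ a, ∑ b, ∑ s, ∑ r, G a b * G s r * (chr D n s a * chr D m r b) =
      (1 / 4) * ((∑ a, ∑ b, ∑ s, ∑ r, G a b * G s r * (D n a s * D m b r)) +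
      (∑ a, ∑ b, ∑ s, ∑ r, G a b * G s r * (D n a s * (D b m r - D r m b))) +
      (∑ a, ∑ b, ∑ s, ∑ r, G a b * G s r * (D m b r * (D a n s - D s n a))) +
      (∑ a, ∑ b, ∑ s, ∑ r, G a b * G s r * (D a n s * D b m r)) +
      (∑ a, ∑ b, ∑ s, ∑ r, G a b * G s r * (D s n a * D r m b)) -
      (∑ a, ∑ b, ∑ s, ∑ r, G a b * G s r * (D a n s * D r m b)) -
      (∑ a, ∑ b, ∑ s, ∑ r, G a b * G s r * (D s n a * D b m r))) := by
    simp only [Finset.mul_sum, ← Finset.sum_add_distrib, ← Finset.sum_sub_distrib]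
    exact sum_congr₄ fun a b s r => by simp only [chr]; ring
  rw [h, hsq, hz1, hz2, hn, hn', hc, hc']
  ring

lemma sum_mul_chr (Gs : ∀ a b, G a b = G b a) (Ds : ∀ a i j, D a i j = D a j i) (s : ι) :
    ∑ a, ∑ b, G a b * chr D a s b = gaugeD G D s := by
  have h1 : ∑ a, ∑ b, G a b * D a b s = ∑ a, ∑ b, G a b * D b s a := by
    rw [Finset.sum_comm]
    refine Finset.sum_congr rfl fun a _ => Finset.sum_congr rfl fun b _ => ?_
    rw [Gs b a, Ds b a s]
  have h2 : ∑ a, ∑ b, G a b * chr D a s b =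
      (1 / 2) * ((∑ a, ∑ b, G a b * D a b s) + (∑ a, ∑ b, G a b * D b s a) -
        ∑ a, ∑ b, G a b * D s a b) := by
    simp only [Finset.mul_sum, ← Finset.sum_add_distrib, ← Finset.sum_sub_distrib]
    refine Finset.sum_congr rfl fun a _ => Finset.sum_congr rfl fun b _ => ?_
    simp only [chr]
    rw [Ds b a s]; ring
  rw [h2, h1]
  simp only [gaugeD, Finset.mul_sum, ← Finset.sum_add_distrib, ← Finset.sum_sub_distrib]
  refine Finset.sum_congr rfl fun a _ => Finset.sum_congr rfl fun b _ => by ring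

lemma gauge_term_eq (Gs : ∀ a b, G a b = G b a) (Ds : ∀ a i j, D a i j = D a j i) (m n : ι) :
    ∑ a, ∑ b, ∑ s, ∑ r, G a b * G s r * (chr D a s b * chr D m r n) =
      ∑ s, ∑ r, G s r * (gaugeD G D s * chr D m r n) := by
  simp only [← sum_mul_chr G D Gs Ds, Finset.sum_mul, Finset.mul_sum]
  rw [sum_comm_pairs]
  exact sum_congr₄ fun a b s r => by ring

/-- Modulo gauge defects and null forms, the quadratic part of the Ricci tensor is
`(1/8) ∂ tr h ∂ tr h - (1/4) ∂h · ∂h`. -/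
lemma quadD_eq (Gs : ∀ a b, G a b = G b a) (Ds : ∀ a i j, D a i j = D a j i) (m n : ι) :
    quadD G D m n = (1 / 8) * (trD G D m * trD G D n) - (1 / 4) * sqD G D m n +
      ((∑ a, ∑ b, G a b * (gaugeD G D b * chr D m a n)) -
        (∑ s, ∑ r, G s r * (gaugeD G D s * chr D m r n)) +
        (1 / 4) * (trD G D m * gaugeD G D n + trD G D n * gaugeD G D m) -
        (1 / 2) * (gaugeD G D n * gaugeD G D m + (1 / 2) * (trD G D n * gaugeD G D m) +
          (1 / 2) * (trD G D m * gaugeD G D n)) +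
        (1 / 4) * ((∑ a, ∑ b, ∑ i, ∑ j, G a b * G i j * commD D b m i j n a) +
        (∑ a, ∑ b, ∑ i, ∑ j, G a b * G i j * commD D b n i j m a)) -
        (1 / 2) * (∑ a, ∑ b, ∑ s, ∑ r, G a b * G s r * commD D a r n s m b) -
        (1 / 4) * (∑ i, ∑ j, G i j * nullD G D i j m n) +
        (1 / 2) * (∑ s, ∑ r, G s r * nullD G D n s m r)) := by
  have h : quadD G D m n =
      (∑ a, ∑ b, ∑ s, ∑ r, G a s * G b r * (D b s r * chr D m a n)) -
      (∑ a, ∑ b, ∑ s, ∑ r, G a s * G b r * (D n s r * chr D m a b)) +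
      (∑ a, ∑ b, ∑ s, ∑ r, G a b * G s r * (chr D n s a * chr D m r b)) -
      ∑ a, ∑ b, ∑ s, ∑ r, G a b * G s r * (chr D a s b * chr D m r n) := by
    simp only [quadD, ← Finset.sum_add_distrib, ← Finset.sum_sub_distrib]
    exact sum_congr₄ fun a b s r => by ring
  rw [h, divergence_term G D Gs, divergence_term_eq G D Gs, derivative_term_eq G D Gs Ds,
    christoffel_sq_eq G D Gs Ds, gauge_term_eq G D Gs Ds, divD_eq, divD_eq]
  ring

end Algebra

end LimitingEinstein

namespace LimitingEinstein

section FourierInversion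

open scoped FourierTransform

variable {n : ℕ}

lemma ft_eq_fourier (u : (Fin n → ℝ) → ℂ) (η : EuclideanSpace ℝ (Fin n)) :
    ft u ((2 * Real.pi) • WithLp.ofLp η) = 𝓕 (fun x : EuclideanSpace ℝ (Fin n) => u x.ofLp) η := by
  rw [Real.fourier_eq', ft,
    ← (PiLp.volume_preserving_toLp (Fin n)).integral_comp
      (MeasurableEquiv.toLp 2 (Fin n → ℝ)).measurableEmbedding]
  refine integral_congr_ae (Eventually.of_forall fun x => ?_)
  simp only [smul_eq_mul, PiLp.inner_apply, RCLike.inner_apply, conj_trivial, Pi.smul_apply]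
  rw [mul_comm]
  congr 2
  push_cast
  rw [Finset.mul_sum, Finset.mul_sum, Finset.sum_mul]
  exact Finset.sum_congr rfl fun i _ => by ring

lemma ftInv_eq_fourierInv (v : (Fin n → ℝ) → ℂ) (x : EuclideanSpace ℝ (Fin n)) :
    ftInv v x.ofLp =
      𝓕⁻ (fun η : EuclideanSpace ℝ (Fin n) => v ((2 * Real.pi) • η.ofLp)) x := by
  have hpi : (0 : ℝ) < 2 * Real.pi := by positivity
  rw [Real.fourierInv_eq', ftInv,
    ← (PiLp.volume_preserving_toLp (Fin n)).integral_comp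
      (MeasurableEquiv.toLp 2 (Fin n → ℝ)).measurableEmbedding]
  have h := Measure.integral_comp_smul (volume : Measure (Fin n → ℝ))
    (fun ξ => v ξ * Complex.exp (Complex.I * (∑ i, x.ofLp i * ξ i))) (2 * Real.pi)
  rw [Module.finrank_fin_fun, abs_of_pos (by positivity), Complex.real_smul] at h
  rw [← h]
  refine integral_congr_ae (Eventually.of_forall fun η => ?_)
  simp only [smul_eq_mul, PiLp.inner_apply, RCLike.inner_apply, conj_trivial, Pi.smul_apply]
  rw [mul_comm]
  congr 2
  push_cast
  rw [Finset.mul_sum, Finset.mul_sum, Finset.sum_mul]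
  exact Finset.sum_congr rfl fun i _ => by ring

/-- The multiplier operator with symbol `1` is the identity on test functions. -/
lemma Tm_one {u : (Fin n → ℝ) → ℂ} (hu : ContDiff ℝ (⊤ : ℕ∞) u) (hc : HasCompactSupport u) :
    Tm (fun _ => 1) u = u := by
  have hu' : ContDiff ℝ (⊤ : ℕ∞) (fun x : EuclideanSpace ℝ (Fin n) => u x.ofLp) :=
    hu.comp (PiLp.contDiff_ofLp)
  have hc' : HasCompactSupport (fun x : EuclideanSpace ℝ (Fin n) => u x.ofLp) :=
    hc.comp_homeomorph (PiLp.homeomorph 2 _)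
  have hi : Integrable (𝓕 (fun x : EuclideanSpace ℝ (Fin n) => u x.ofLp)) := by
    have := (𝓕 (hc'.toSchwartzMap hu')).integrable (μ := volume)
    rwa [SchwartzMap.fourier_coe] at this
  have h := hu'.continuous.fourierInv_fourier_eq
    (hu'.continuous.integrable_of_hasCompactSupport hc') hi
  funext x
  refine (ftInv_eq_fourierInv _ (WithLp.toLp 2 x)).trans ?_
  simp only [Complex.ofReal_one, one_mul, ft_eq_fourier]
  exact congrFun h (WithLp.toLp 2 x)

end FourierInversion

end LimitingEinstein

namespace LimitingEinstein

section WeakNull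

open Asymptotics

variable {d : ℕ} {O : Set (Vec d)}

/-- The filter `n → ∞`, uniformly for `x ∈ O`. -/
abbrev unifOn (O : Set (Vec d)) : Filter (ℕ × Vec d) := atTop ×ˢ 𝓟 O

/-- Sequences of functions, continuous on `O`, converging to zero in distributions on `O`. -/
def WeakNull (O : Set (Vec d)) (F : ℕ × Vec d → ℝ) : Prop :=
  (∀ n, ContinuousOn (fun x => F (n, x)) O) ∧
  ∀ ψ : Vec d → ℝ, ContDiff ℝ (⊤ : ℕ∞) ψ → HasCompactSupport ψ → tsupport ψ ⊆ O →
    Tendsto (fun n => ∫ x, ψ x * F (n, x)) atTop (𝓝 0)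

lemma continuous_mul_of_tsupport_subset (hO : IsOpen O) {ψ f : Vec d → ℝ} (hψ : Continuous ψ)
    (hs : tsupport ψ ⊆ O) (hf : ContinuousOn f O) : Continuous (fun x => ψ x * f x) := by
  refine continuous_of_tsupport fun x hx => ?_
  have hx' : x ∈ O := hs (closure_mono (Function.support_mul_subset_left ψ f) hx)
  exact hψ.continuousAt.mul (hf.continuousAt (hO.mem_nhds hx'))

lemma integrable_mul_of_tsupport_subset (hO : IsOpen O) {ψ f : Vec d → ℝ} (hψ : Continuous ψ)
    (hc : HasCompactSupport ψ) (hs : tsupport ψ ⊆ O) (hf : ContinuousOn f O) :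
    Integrable (fun x => ψ x * f x) :=
  (continuous_mul_of_tsupport_subset hO hψ hs hf).integrable_of_hasCompactSupport hc.mul_right

namespace WeakNull

variable {F F' : ℕ × Vec d → ℝ}

lemma add (hO : IsOpen O) (hF : WeakNull O F) (hF' : WeakNull O F') :
    WeakNull O (fun p => F p + F' p) := by
  refine ⟨fun n => (hF.1 n).add (hF'.1 n), fun ψ h1 h2 h3 => ?_⟩
  have h := (hF.2 ψ h1 h2 h3).add (hF'.2 ψ h1 h2 h3)
  rw [add_zero] at h
  refine h.congr fun n => ?_
  rw [← integral_add (integrable_mul_of_tsupport_subset hO h1.continuous h2 h3 (hF.1 n))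
    (integrable_mul_of_tsupport_subset hO h1.continuous h2 h3 (hF'.1 n))]
  simp only [mul_add]

lemma smooth_mul {c : Vec d → ℝ} (hc : ContDiff ℝ (⊤ : ℕ∞) c) (hF : WeakNull O F) :
    WeakNull O (fun p => c p.2 * F p) := by
  refine ⟨fun n => hc.continuous.continuousOn.mul (hF.1 n), fun ψ h1 h2 h3 => ?_⟩
  have h := hF.2 (fun x => ψ x * c x) (h1.mul hc) h2.mul_right
    ((closure_mono (Function.support_mul_subset_left ψ c)).trans h3)
  simpa only [mul_assoc] using h

lemma const_mul (c : ℝ) (hF : WeakNull O F) : WeakNull O (fun p => c * F p) :=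
  hF.smooth_mul contDiff_const

lemma neg (hF : WeakNull O F) : WeakNull O (fun p => - F p) := by
  simpa using hF.const_mul (-1)

lemma sub (hO : IsOpen O) (hF : WeakNull O F) (hF' : WeakNull O F') :
    WeakNull O (fun p => F p - F' p) := by
  simpa only [sub_eq_add_neg] using hF.add hO hF'.neg

lemma zero : WeakNull O (fun _ => 0) :=
  ⟨fun _ => continuousOn_const, fun ψ _ _ _ => by simp⟩

lemma sum (hO : IsOpen O) {ι : Type*} {s : Finset ι} {F : ι → ℕ × Vec d → ℝ}
    (hF : ∀ i ∈ s, WeakNull O (F i)) : WeakNull O (fun p => ∑ i ∈ s, F i p) := by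
  classical
  induction s using Finset.induction_on with
  | empty => simpa using zero
  | insert a s ha ih =>
    simp only [Finset.sum_insert ha]
    exact (hF a (Finset.mem_insert_self a s)).add hO
      (ih fun i hi => hF i (Finset.mem_insert_of_mem hi))

lemma congr (hF : WeakNull O F) (h : ∀ n, ∀ x ∈ O, F' (n, x) = F (n, x)) : WeakNull O F' := by
  refine ⟨fun n => (hF.1 n).congr (h n), fun ψ h1 h2 h3 => ?_⟩
  refine (hF.2 ψ h1 h2 h3).congr fun n => integral_congr_ae (Eventually.of_forall fun x => ?_)
  by_cases hx : x ∈ O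
  · simp only [h n x hx]
  · simp [image_eq_zero_of_notMem_tsupport fun hx' => hx (h3 hx')]

lemma of_tendsto (hFc : ∀ n, ContinuousOn (fun x => F (n, x)) O)
    (hF : Tendsto F (unifOn O) (𝓝 0)) : WeakNull O F := by
  refine ⟨hFc, fun ψ h1 h2 h3 => ?_⟩
  have hψi : Integrable (fun x => |ψ x|) :=
    (h1.continuous.integrable_of_hasCompactSupport h2).abs
  rw [Metric.tendsto_atTop]
  intro ε hε
  set M := ∫ x, |ψ x| with hM
  have hM0 : 0 ≤ M := integral_nonneg fun x => abs_nonneg _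
  have h := (Metric.tendsto_nhds.1 hF) (ε / (M + 1)) (by positivity)
  rw [unifOn, eventually_prod_principal_iff, eventually_atTop] at h
  obtain ⟨N, hN⟩ := h
  refine ⟨N, fun n hn => ?_⟩
  have hle : ‖∫ x, ψ x * F (n, x)‖ ≤ ∫ x, |ψ x| * (ε / (M + 1)) := by
    refine norm_integral_le_of_norm_le (hψi.mul_const _) (Eventually.of_forall fun x => ?_)
    rw [norm_mul, Real.norm_eq_abs]
    by_cases hx : x ∈ O
    · have := hN n hn x hx
      rw [dist_zero_right] at this
      gcongr
    · simp [image_eq_zero_of_notMem_tsupport fun hx' => hx (h3 hx')]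
  rw [dist_zero_right]
  refine hle.trans_lt ?_
  rw [integral_mul_const, ← hM, mul_div_assoc', div_lt_iff₀ (by positivity)]
  nlinarith

lemma pd (hO : IsOpen O) (a : Fin (d + 1)) (hF : WeakNull O F)
    (hd : ∀ n, ContDiffOn ℝ 1 (fun x => F (n, x)) O) :
    WeakNull O (fun p => pd a (fun x => F (p.1, x)) p.2) := by
  have hc : ∀ n, ContinuousOn (fun x => _root_.pd a (fun y => F (n, y)) x) O := fun n =>
    ((hd n).continuousOn_fderiv_of_isOpen hO le_rfl).clm_apply continuousOn_const
  refine ⟨hc, fun ψ h1 h2 h3 => ?_⟩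
  have hψ' : ContDiff ℝ (⊤ : ℕ∞) (fun x => _root_.pd a ψ x) :=
    (h1.fderiv_right le_rfl).clm_apply contDiff_const
  have hψc : HasCompactSupport (fun x => _root_.pd a ψ x) := 
    h2.fderiv_apply ℝ _
  have hψs : tsupport (fun x => _root_.pd a ψ x) ⊆ O :=
    (tsupport_fderiv_apply_subset ℝ _).trans h3
  have h := (hF.2 _ hψ' hψc hψs).neg
  rw [neg_zero] at h
  refine h.congr fun n => ?_
  refine (integral_mul_fderiv_eq_neg_fderiv_mul_of_integrable
    (integrable_mul_of_tsupport_subset hO hψ'.continuous hψc hψs (hF.1 n))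
    (integrable_mul_of_tsupport_subset hO h1.continuous h2 h3 (hc n))
    (integrable_mul_of_tsupport_subset hO h1.continuous h2 h3 (hF.1 n))
    (fun x _ => h1.differentiable (by simp) x)
    (fun x hx => ((hd n).contDiffAt (hO.mem_nhds (h3 hx))).differentiableAt (by simp))).symm

end WeakNull

end WeakNull

end LimitingEinstein

namespace LimitingEinstein

section UnifO

open Asymptotics

variable {d : ℕ} {O : Set (Vec d)}

/-- Sequences of functions, continuous on `O`, of size `O(r n)` uniformly on `O`. -/
structure UnifO (O : Set (Vec d)) (r : ℕ → ℝ) (F : ℕ × Vec d → ℝ) : Prop where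
  cont : ∀ n, ContinuousOn (fun x => F (n, x)) O
  bound : F =O[unifOn O] fun p => r p.1

/-- Boundedness on `O`, uniformly in `n`. -/
abbrev UnifBdd (O : Set (Vec d)) (F : ℕ × Vec d → ℝ) : Prop := UnifO O (fun _ => 1) F

namespace UnifO

variable {r r' : ℕ → ℝ} {F F' : ℕ × Vec d → ℝ}

lemma of_le (C : ℝ) (hc : ∀ n, ContinuousOn (fun x => F (n, x)) O)
    (h : ∀ᶠ n in atTop, ∀ x ∈ O, |F (n, x)| ≤ C * |r n|) : UnifO O r F := by
  refine ⟨hc, IsBigO.of_bound C ?_⟩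
  rw [unifOn, eventually_prod_principal_iff]
  exact h

lemma add (h : UnifO O r F) (h' : UnifO O r F') : UnifO O r (fun p => F p + F' p) :=
  ⟨fun n => (h.cont n).add (h'.cont n), h.bound.add h'.bound⟩

lemma sub (h : UnifO O r F) (h' : UnifO O r F') : UnifO O r (fun p => F p - F' p) :=
  ⟨fun n => (h.cont n).sub (h'.cont n), h.bound.sub h'.bound⟩

lemma neg (h : UnifO O r F) : UnifO O r (fun p => - F p) :=
  ⟨fun n => (h.cont n).neg, h.bound.neg_left⟩

lemma mul (h : UnifO O r F) (h' : UnifO O r' F') :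
    UnifO O (fun n => r n * r' n) (fun p => F p * F' p) :=
  ⟨fun n => (h.cont n).mul (h'.cont n), h.bound.mul h'.bound⟩

lemma bdd_mul (h : UnifBdd O F) (h' : UnifO O r F') : UnifO O r (fun p => F p * F' p) := by
  simpa only [one_mul] using h.mul h'

lemma mul_bdd (h : UnifO O r F) (h' : UnifBdd O F') : UnifO O r (fun p => F p * F' p) := by
  simpa only [mul_one] using h.mul h'

lemma const_mul (c : ℝ) (h : UnifO O r F) : UnifO O r (fun p => c * F p) :=
  ⟨fun n => (h.cont n).const_mul c, h.bound.const_mul_left c⟩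

lemma sum {ι : Type*} {s : Finset ι} {F : ι → ℕ × Vec d → ℝ} (h : ∀ i ∈ s, UnifO O r (F i)) :
    UnifO O r (fun p => ∑ i ∈ s, F i p) :=
  ⟨fun n => continuousOn_finsetSum s fun i hi => (h i hi).cont n,
    IsBigO.fun_sum fun i hi => (h i hi).bound⟩

lemma mono (h : UnifO O r F) (hr : r =O[atTop] r') : UnifO O r' F :=
  ⟨h.cont, h.bound.trans (hr.comp_tendsto tendsto_fst)⟩

lemma congr (h : UnifO O r F) (he : ∀ n, ∀ x ∈ O, F' (n, x) = F (n, x)) : UnifO O r F' := by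
  refine ⟨fun n => (h.cont n).congr (he n), h.bound.congr' ?_ EventuallyEq.rfl⟩
  rw [EventuallyEq, unifOn, eventually_prod_principal_iff]
  exact Eventually.of_forall fun n x hx => (he n x hx).symm

lemma of_continuous (hK : IsCompact (closure O)) {c : Vec d → ℝ} (hc : Continuous c) :
    UnifBdd O (fun p => c p.2) := by
  obtain ⟨C, hC⟩ := hK.exists_bound_of_continuousOn hc.continuousOn
  exact of_le C (fun _ => hc.continuousOn)
    (Eventually.of_forall fun n x hx => by simpa using hC x (subset_closure hx))

lemma weakNull (h : UnifO O r F) (hr : Tendsto r atTop (𝓝 0)) : WeakNull O F :=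
  .of_tendsto h.cont (h.bound.trans_tendsto (hr.comp tendsto_fst))

end UnifO

end UnifO

section Metric

variable {d : ℕ} {O : Set (Vec d)} {g : Met d}

lemma contDiffOn_pd (hO : IsOpen O) {f : Vec d → ℝ} (hf : ContDiffOn ℝ (⊤ : ℕ∞) f O)
    (a : Fin (d + 1)) : ContDiffOn ℝ (⊤ : ℕ∞) (pd a f) O :=
  (hf.fderiv_of_isOpen hO le_rfl).clm_apply contDiffOn_const

lemma contDiffOn_det {ι : Type*} [Fintype ι] [DecidableEq ι] {A : Vec d → Matrix ι ι ℝ}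
    (hA : ∀ i j, ContDiffOn ℝ (⊤ : ℕ∞) (fun x => A x i j) O) :
    ContDiffOn ℝ (⊤ : ℕ∞) (fun x => (A x).det) O := by
  simp only [Matrix.det_apply']
  exact ContDiffOn.sum fun σ _ => contDiffOn_const.mul (contDiffOn_prod fun i _ => hA _ _)

lemma contDiffOn_ginv (hg : IsMetricOn g O) (i j : Fin (d + 1)) :
    ContDiffOn ℝ (⊤ : ℕ∞) (fun x => ginv g x i j) O := by
  have h : ∀ x, ginv g x i j = ((g x).det)⁻¹ * ((g x).updateRow j (Pi.single i 1)).det := by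
    intro x
    rw [ginv, Matrix.inv_def, Matrix.smul_apply, Matrix.adjugate_apply, Ring.inverse_eq_inv',
      smul_eq_mul]
  simp only [h]
  refine ((contDiffOn_det hg.1).inv fun x hx => (hg.2.2 x hx).ne_zero).mul
    (contDiffOn_det fun k l => ?_)
  by_cases hk : k = j
  · subst hk
    simpa only [Matrix.updateRow_self] using contDiffOn_const
  · simpa only [Matrix.updateRow_ne hk] using hg.1 k l

lemma ginv_symm (hg : IsMetricOn g O) {x : Vec d} (hx : x ∈ O) (i j : Fin (d + 1)) :
    ginv g x i j = ginv g x j i := by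
  have h : ((g x)⁻¹).IsSymm := by
    rw [Matrix.IsSymm, Matrix.transpose_nonsing_inv, (hg.2.1 x hx).eq]
  exact (h.apply i j).symm

lemma ginv_mul (hg : IsMetricOn g O) {x : Vec d} (hx : x ∈ O) (i j : Fin (d + 1)) :
    ∑ k, ginv g x i k * g x k j = if i = j then 1 else 0 := by
  have h := Matrix.nonsing_inv_mul (g x) (hg.2.2 x hx)
  have := congrFun (congrFun h i) j
  rwa [Matrix.mul_apply, Matrix.one_apply] at this

lemma mul_ginv (hg : IsMetricOn g O) {x : Vec d} (hx : x ∈ O) (i j : Fin (d + 1)) :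
    ∑ k, g x i k * ginv g x k j = if i = j then 1 else 0 := by
  have h := Matrix.mul_nonsing_inv (g x) (hg.2.2 x hx)
  have := congrFun (congrFun h i) j
  rwa [Matrix.mul_apply, Matrix.one_apply] at this

/-- The array of first derivatives of a matrix field. -/
def dg (p : SymMat d) (x : Vec d) (a i j : Fin (d + 1)) : ℝ := pd a (fun y => p y i j) x

/-- The array of second derivatives of a matrix field. -/
def ddg (p : SymMat d) (x : Vec d) (b a i j : Fin (d + 1)) : ℝ :=
  pd b (fun z => pd a (fun y => p y i j) z) x

lemma pd_add {f f' : Vec d → ℝ} {x : Vec d} (a : Fin (d + 1)) (hf : DifferentiableAt ℝ f x)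
    (hf' : DifferentiableAt ℝ f' x) :
    pd a (fun y => f y + f' y) x = pd a f x + pd a f' x := by
  simp only [pd, fderiv_fun_add hf hf', add_apply]

lemma pd_sub {f f' : Vec d → ℝ} {x : Vec d} (a : Fin (d + 1)) (hf : DifferentiableAt ℝ f x)
    (hf' : DifferentiableAt ℝ f' x) :
    pd a (fun y => f y - f' y) x = pd a f x - pd a f' x := by
  simp only [pd, fderiv_fun_sub hf hf', sub_apply]

lemma pd_mul {f f' : Vec d → ℝ} {x : Vec d} (a : Fin (d + 1)) (hf : DifferentiableAt ℝ f x)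
    (hf' : DifferentiableAt ℝ f' x) :
    pd a (fun y => f y * f' y) x = pd a f x * f' x + f x * pd a f' x := by
  simp only [pd, fderiv_fun_mul hf hf', add_apply, smul_apply, smul_eq_mul]
  ring

lemma pd_const_mul {f : Vec d → ℝ} {x : Vec d} (a : Fin (d + 1)) (c : ℝ)
    (hf : DifferentiableAt ℝ f x) : pd a (fun y => c * f y) x = c * pd a f x := by
  simp only [pd, fderiv_const_mul hf, smul_apply, smul_eq_mul]

lemma pd_sum {ι : Type*} {s : Finset ι} {f : ι → Vec d → ℝ} {x : Vec d} (a : Fin (d + 1))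
    (hf : ∀ i ∈ s, DifferentiableAt ℝ (f i) x) :
    pd a (fun y => ∑ i ∈ s, f i y) x = ∑ i ∈ s, pd a (f i) x := by
  simp only [pd, fderiv_fun_sum hf, sum_apply]

lemma pd_congr {f f' : Vec d → ℝ} {x : Vec d} (a : Fin (d + 1)) (hO : IsOpen O) (hx : x ∈ O)
    (h : ∀ y ∈ O, f y = f' y) : pd a f x = pd a f' x := by
  have : f =ᶠ[𝓝 x] f' := Filter.eventuallyEq_of_mem (hO.mem_nhds hx) h
  simp only [pd, this.fderiv_eq]

lemma pd_comm (hO : IsOpen O) {f : Vec d → ℝ} (hf : ContDiffOn ℝ (⊤ : ℕ∞) f O) {x : Vec d}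
    (hx : x ∈ O) (a b : Fin (d + 1)) :
    pd a (fun z => pd b f z) x = pd b (fun z => pd a f z) x := by
  have hfx : ContDiffAt ℝ (⊤ : ℕ∞) f x := hf.contDiffAt (hO.mem_nhds hx)
  have hd : DifferentiableAt ℝ (fderiv ℝ f) x :=
    (hfx.fderiv_right (m := 1) (by norm_cast)).differentiableAt (by simp)
  have hs : IsSymmSndFDerivAt ℝ f x := hfx.isSymmSndFDerivAt (by
    rw [minSmoothness_of_isRCLikeNormedField]; exact WithTop.coe_le_coe.2 le_top)
  have h : ∀ c e : Fin (d + 1), pd c (fun z => pd e f z) x =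
      fderiv ℝ (fderiv ℝ f) x (Pi.single c 1) (Pi.single e 1) := by
    intro c e
    simp only [pd]
    rw [fderiv_clm_apply hd (differentiableAt_const _)]
    simp
  rw [h, h, hs.eq]

end Metric

end LimitingEinstein

namespace LimitingEinstein

open Asymptotics

variable {d : ℕ}

/-- The perturbation `g_n - g_0`. -/
def hDiff (g0 : Met d) (g : ℕ → Met d) (n : ℕ) : SymMat d :=
  fun x => Matrix.of fun i j => g n x i j - g0 x i j

lemma seq_eq_add_hDiff (g0 : Met d) (g : ℕ → Met d) (n : ℕ) (x : Vec d) (i j : Fin (d + 1)) :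
    g n x i j = g0 x i j + hDiff g0 g n x i j := by
  simp [hDiff]

/-- Vacuum metrics `g_n` converging to `g0` on `O` at the high-frequency rate `lam`, in
generalized wave gauge up to `s`, and whose commutator null forms vanish weakly. -/
structure HighFrequency (O : Set (Vec d)) (g0 : Met d) (g : ℕ → Met d) (lam s : ℕ → ℝ) (C : ℝ) :
    Prop where
  isOpen : IsOpen O
  compact : IsCompact (closure O)
  lam_pos : ∀ n, 0 < lam n
  lam_le_one : ∀ n, lam n ≤ 1
  lam_tendsto : Tendsto lam atTop (𝓝 0)
  lam_le : ∀ n, lam n ≤ s n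
  gauge_tendsto : Tendsto s atTop (𝓝 0)
  limit : IsMetricOn g0 Set.univ
  metric : ∀ n, IsMetricOn (g n) O
  ricci : ∀ n, ∀ x ∈ O, ∀ m k, RicciC (g n) m k x = 0
  bound_diff : ∀ n, ∀ x ∈ O, ∀ i j, |hDiff g0 g n x i j| ≤ lam n
  bound_pd : ∀ n, ∀ x ∈ O, ∀ a i j, |dg (hDiff g0 g n) x a i j| ≤ C
  bound_pd_pd : ∀ n, ∀ x ∈ O, ∀ a b i j, |ddg (hDiff g0 g n) x b a i j| ≤ C * (lam n)⁻¹
  bound_gauge : ∀ n, ∀ x ∈ O, ∀ r, |Hgauge (g n) (g n) r x - Hgauge g0 g0 r x| ≤ C * s n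
  bound_pd_gauge : ∀ n, ∀ x ∈ O, ∀ a r, |pd a (Hgauge (g n) (g n) r) x| ≤ C
  comm : ∀ a b i j k l, WeakNull O fun p => commD (dg (hDiff g0 g p.1) p.2) a b i j k l

namespace HighFrequency

variable {O : Set (Vec d)} {g0 : Met d} {g : ℕ → Met d} {lam s : ℕ → ℝ} {C : ℝ}

section Regularity

variable (H : HighFrequency O g0 g lam s C)
include H

lemma contDiff_limit (i j : Fin (d + 1)) : ContDiff ℝ (⊤ : ℕ∞) (fun x => g0 x i j) :=
  contDiffOn_univ.1 (H.limit.1 i j)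

lemma contDiff_ginv_limit (i j : Fin (d + 1)) : ContDiff ℝ (⊤ : ℕ∞) (fun x => ginv g0 x i j) :=
  contDiffOn_univ.1 (contDiffOn_ginv H.limit i j)

lemma contDiffOn_diff (n : ℕ) (i j : Fin (d + 1)) :
    ContDiffOn ℝ (⊤ : ℕ∞) (fun x => hDiff g0 g n x i j) O :=
  ((H.metric n).1 i j).sub (H.contDiff_limit i j).contDiffOn

lemma differentiableAt {f : Vec d → ℝ} (hf : ContDiffOn ℝ (⊤ : ℕ∞) f O) {x : Vec d}
    (hx : x ∈ O) : DifferentiableAt ℝ f x :=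
  (hf.contDiffAt (H.isOpen.mem_nhds hx)).differentiableAt (by simp)

lemma contDiff_dg_limit (a i j : Fin (d + 1)) :
    ContDiff ℝ (⊤ : ℕ∞) (fun x => dg g0 x a i j) :=
  contDiffOn_univ.1 (contDiffOn_pd isOpen_univ (H.limit.1 i j) a)

lemma contDiff_ddg_limit (b a i j : Fin (d + 1)) :
    ContDiff ℝ (⊤ : ℕ∞) (fun x => ddg g0 x b a i j) :=
  contDiffOn_univ.1 (contDiffOn_pd isOpen_univ (contDiffOn_pd isOpen_univ (H.limit.1 i j) a) b)

lemma contDiffOn_dg_diff (n : ℕ) (a i j : Fin (d + 1)) :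
    ContDiffOn ℝ (⊤ : ℕ∞) (fun x => dg (hDiff g0 g n) x a i j) O :=
  contDiffOn_pd H.isOpen (H.contDiffOn_diff n i j) a

lemma contDiffOn_ddg_diff (n : ℕ) (b a i j : Fin (d + 1)) :
    ContDiffOn ℝ (⊤ : ℕ∞) (fun x => ddg (hDiff g0 g n) x b a i j) O :=
  contDiffOn_pd H.isOpen (H.contDiffOn_dg_diff n a i j) b

lemma dg_seq (n : ℕ) {x : Vec d} (hx : x ∈ O) (a i j : Fin (d + 1)) :
    dg (g n) x a i j = dg g0 x a i j + dg (hDiff g0 g n) x a i j := by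
  simp only [dg, seq_eq_add_hDiff g0 g n _ i j]
  exact pd_add a (H.differentiableAt (H.contDiff_limit i j).contDiffOn hx)
    (H.differentiableAt (H.contDiffOn_diff n i j) hx)

lemma ddg_seq (n : ℕ) {x : Vec d} (hx : x ∈ O) (b a i j : Fin (d + 1)) :
    ddg (g n) x b a i j = ddg g0 x b a i j + ddg (hDiff g0 g n) x b a i j := by
  exact (pd_congr b H.isOpen hx fun y hy => H.dg_seq n hy a i j).trans <| pd_add b (H.differentiableAt (H.contDiff_dg_limit a i j).contDiffOn hx)
    (H.differentiableAt (H.contDiffOn_dg_diff n a i j) hx)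

end Regularity

section Bounds

variable (H : HighFrequency O g0 g lam s C)
include H

lemma lam_inv_mul : (fun n => lam n * (lam n)⁻¹) = fun _ => 1 :=
  funext fun n => mul_inv_cancel₀ (H.lam_pos n).ne'

lemma one_isBigO_lam_inv : (fun _ : ℕ => (1 : ℝ)) =O[atTop] fun n => (lam n)⁻¹ :=
  IsBigO.of_bound 1 (Eventually.of_forall fun n => by
    rw [norm_one, one_mul, norm_inv, Real.norm_of_nonneg (H.lam_pos n).le]
    exact (one_le_inv₀ (H.lam_pos n)).2 (H.lam_le_one n))

lemma lam_isBigO_one : lam =O[atTop] fun _ : ℕ => (1 : ℝ) :=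
  IsBigO.of_bound 1 (Eventually.of_forall fun n => by
    simpa [abs_of_pos (H.lam_pos n)] using H.lam_le_one n)

lemma lam_isBigO_gauge : lam =O[atTop] s :=
  IsBigO.of_bound 1 (Eventually.of_forall fun n => by
    rw [Real.norm_of_nonneg (H.lam_pos n).le, one_mul]
    exact (H.lam_le n).trans (le_abs_self _))

lemma limit_bdd {c : Vec d → ℝ} (hc : ContDiff ℝ (⊤ : ℕ∞) c) : UnifBdd O (fun p => c p.2) :=
  .of_continuous H.compact hc.continuous

lemma diff_unifO (i j : Fin (d + 1)) : UnifO O lam (fun p => hDiff g0 g p.1 p.2 i j) :=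
  .of_le 1 (fun n => (H.contDiffOn_diff n i j).continuousOn) (Eventually.of_forall fun n x hx => by
    rw [one_mul, abs_of_pos (H.lam_pos n)]; exact H.bound_diff n x hx i j)

lemma dg_diff_bdd (a i j : Fin (d + 1)) :
    UnifBdd O (fun p => dg (hDiff g0 g p.1) p.2 a i j) :=
  .of_le C (fun n => (H.contDiffOn_dg_diff n a i j).continuousOn)
    (Eventually.of_forall fun n x hx => by simpa using H.bound_pd n x hx a i j)

lemma ddg_diff_unifO (b a i j : Fin (d + 1)) :
    UnifO O (fun n => (lam n)⁻¹) (fun p => ddg (hDiff g0 g p.1) p.2 b a i j) :=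
  .of_le C (fun n => (H.contDiffOn_ddg_diff n b a i j).continuousOn)
    (Eventually.of_forall fun n x hx => by
      rw [abs_of_pos (inv_pos.2 (H.lam_pos n))]; exact H.bound_pd_pd n x hx a b i j)

lemma seq_bdd (i j : Fin (d + 1)) : UnifBdd O (fun p => g p.1 p.2 i j) :=
  ((H.limit_bdd (H.contDiff_limit i j)).add ((H.diff_unifO i j).mono H.lam_isBigO_one)).congr
    fun n x _ => seq_eq_add_hDiff g0 g n x i j

lemma dg_seq_bdd (a i j : Fin (d + 1)) : UnifBdd O (fun p => dg (g p.1) p.2 a i j) :=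
  ((H.limit_bdd (H.contDiff_dg_limit a i j)).add (H.dg_diff_bdd a i j)).congr
    fun n _ hx => H.dg_seq n hx a i j

lemma ddg_seq_unifO (b a i j : Fin (d + 1)) :
    UnifO O (fun n => (lam n)⁻¹) (fun p => ddg (g p.1) p.2 b a i j) :=
  (((H.limit_bdd (H.contDiff_ddg_limit b a i j)).mono H.one_isBigO_lam_inv).add
    (H.ddg_diff_unifO b a i j)).congr fun n _ hx => H.ddg_seq n hx b a i j

lemma ginv_sub (n : ℕ) {x : Vec d} (hx : x ∈ O) (i j : Fin (d + 1)) :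
    ginv (g n) x i j - ginv g0 x i j =
      - ∑ a, ∑ b, ginv (g n) x i a * hDiff g0 g n x a b * ginv g0 x b j := by
  have h : ginv (g n) x - ginv g0 x = - (ginv (g n) x * hDiff g0 g n x * ginv g0 x) := by
    have h1 : ginv (g n) x * g n x = 1 := Matrix.nonsing_inv_mul _ ((H.metric n).2.2 x hx)
    have h2 : g0 x * ginv g0 x = 1 := Matrix.mul_nonsing_inv _ (H.limit.2.2 x (Set.mem_univ x))
    have h3 : hDiff g0 g n x = g n x - g0 x := by ext; simp [hDiff]
    rw [h3, mul_sub, sub_mul, h1, mul_assoc, h2]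
    simp
  have h' := congrFun (congrFun h i) j
  rw [Matrix.sub_apply, Matrix.neg_apply, Matrix.mul_apply] at h'
  rw [h', neg_inj, Finset.sum_comm]
  exact Finset.sum_congr rfl fun b _ => by rw [Matrix.mul_apply, Finset.sum_mul]

lemma ginv_seq_bdd (i j : Fin (d + 1)) : UnifBdd O (fun p => ginv (g p.1) p.2 i j) := by
  have hG : ∃ B : ℝ, ∀ x ∈ O, ∀ i j, |ginv g0 x i j| ≤ B := by
    have h : Continuous fun x => fun q : Fin (d + 1) × Fin (d + 1) => ginv g0 x q.1 q.2 :=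
      continuous_pi fun q => (H.contDiff_ginv_limit q.1 q.2).continuous
    obtain ⟨B, hB⟩ := H.compact.exists_bound_of_continuousOn h.continuousOn
    exact ⟨B, fun x hx i j => (norm_le_pi_norm _ (i, j)).trans (hB x (subset_closure hx))⟩
  obtain ⟨B, hB⟩ := hG
  set N : ℝ := ((d + 1 : ℕ) : ℝ) with hN
  have hev : ∀ᶠ n in atTop, lam n * (N * N * B) ≤ 1 / 2 := by
    have h := H.lam_tendsto.mul_const (N * N * B)
    rw [zero_mul] at h
    exact (h.eventually (gt_mem_nhds one_half_pos)).mono fun n hn => hn.le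
  refine .of_le (2 * (N * N * B))
    (fun n => (contDiffOn_ginv (H.metric n) i j).continuousOn) (hev.mono fun n hn x hx => ?_)
  set S := ∑ i, ∑ j, |ginv (g n) x i j| with hS
  have hle : ∀ i j, |ginv (g n) x i j| ≤ B + (∑ a, |ginv (g n) x i a|) * (lam n * (N * B)) := by
    intro i j
    have h1 := H.ginv_sub n hx i j
    have h2 : |∑ a, ∑ b, ginv (g n) x i a * hDiff g0 g n x a b * ginv g0 x b j| ≤
        (∑ a, |ginv (g n) x i a|) * (lam n * (N * B)) := by
      rw [Finset.sum_mul]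
      refine (Finset.abs_sum_le_sum_abs _ _).trans (Finset.sum_le_sum fun a _ => ?_)
      refine (Finset.abs_sum_le_sum_abs _ _).trans ?_
      calc ∑ b, |ginv (g n) x i a * hDiff g0 g n x a b * ginv g0 x b j|
          ≤ ∑ _b : Fin (d + 1), |ginv (g n) x i a| * lam n * B := by
            refine Finset.sum_le_sum fun b _ => ?_
            rw [abs_mul, abs_mul]
            have := hB x hx b j
            have := H.bound_diff n x hx a b
            have := (H.lam_pos n).le
            gcongr
        _ = |ginv (g n) x i a| * (lam n * (N * B)) := by
            rw [Finset.sum_const, Finset.card_univ, Fintype.card_fin, nsmul_eq_mul]; ring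
    have h3 : ginv (g n) x i j = ginv g0 x i j + (ginv (g n) x i j - ginv g0 x i j) := by ring
    rw [h3]
    refine (abs_add_le _ _).trans (add_le_add (hB x hx i j) ?_)
    rwa [h1, abs_neg]
  have hSle : S ≤ N * N * B + S * (lam n * (N * N * B)) := by
    calc S ≤ ∑ i, ∑ _j : Fin (d + 1),
          (B + (∑ a, |ginv (g n) x i a|) * (lam n * (N * B))) :=
        Finset.sum_le_sum fun i _ => Finset.sum_le_sum fun j _ => hle i j
      _ = N * N * B + S * (lam n * (N * N * B)) := by
        simp only [Finset.sum_const, Finset.card_univ, Fintype.card_fin, nsmul_eq_mul,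
          ← Finset.mul_sum, Finset.sum_add_distrib, ← Finset.sum_mul]
        ring
  have hS0 : 0 ≤ S := Finset.sum_nonneg fun i _ => Finset.sum_nonneg fun j _ => abs_nonneg _
  have hij : |ginv (g n) x i j| ≤ S :=
    (Finset.single_le_sum (f := fun j => |ginv (g n) x i j|) (fun j _ => abs_nonneg _)
      (Finset.mem_univ j)).trans
    (Finset.single_le_sum (f := fun i => ∑ j, |ginv (g n) x i j|)
      (fun i _ => Finset.sum_nonneg fun j _ => abs_nonneg _) (Finset.mem_univ i))
  rw [abs_one, mul_one]
  nlinarith [mul_le_mul_of_nonneg_left hn hS0]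

lemma ginv_sub_unifO (i j : Fin (d + 1)) :
    UnifO O lam (fun p => ginv (g p.1) p.2 i j - ginv g0 p.2 i j) :=
  (UnifO.neg <| .sum fun a _ => .sum fun b _ =>
    ((H.ginv_seq_bdd i a).bdd_mul (H.diff_unifO a b)).mul_bdd
      (H.limit_bdd (H.contDiff_ginv_limit b j))).congr fun n _ hx => H.ginv_sub n hx i j

/-- The inverse metrics to first order in the perturbation. -/
lemma ginv_expansion (i j : Fin (d + 1)) :
    UnifO O (fun n => lam n * lam n) (fun p => ginv (g p.1) p.2 i j - ginv g0 p.2 i j +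
      ∑ a, ∑ b, ginv g0 p.2 i a * hDiff g0 g p.1 p.2 a b * ginv g0 p.2 b j) := by
  refine (UnifO.neg <| .sum (s := Finset.univ) fun a _ => .sum (s := Finset.univ) fun b _ =>
    ((H.ginv_sub_unifO i a).mul (H.diff_unifO a b)).mul_bdd
      (H.limit_bdd (H.contDiff_ginv_limit b j))).congr fun n x hx => ?_
  simp only [H.ginv_sub n hx i j, sub_mul, Finset.sum_sub_distrib]
  ring

lemma pd_ginv_seq_bdd (c i j : Fin (d + 1)) :
    UnifBdd O (fun p => pd c (fun y => ginv (g p.1) y i j) p.2) := by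
  refine (UnifO.neg <| .sum (s := Finset.univ) fun a _ => .sum (s := Finset.univ) fun b _ =>
    ((H.ginv_seq_bdd i a).bdd_mul (H.dg_seq_bdd c a b)).mul_bdd (H.ginv_seq_bdd b j)).congr
      fun n x hx => ?_
  have hi := fun a b => H.differentiableAt (contDiffOn_ginv (H.metric n) a b) hx
  have hg := fun a b => H.differentiableAt ((H.metric n).1 a b) hx
  have h : ∀ b, ∑ a, pd c (fun y => ginv (g n) y i a) x * g n x a b =
      - ∑ a, ginv (g n) x i a * dg (g n) x c a b := by
    intro b
    have h0 : pd c (fun y => ∑ a, ginv (g n) y i a * g n y a b) x = 0 := by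
      rw [pd_congr c H.isOpen hx fun y hy => ginv_mul (H.metric n) hy i b]
      simp [pd]
    rw [pd_sum c (f := fun a y => ginv (g n) y i a * g n y a b)
      fun a _ => (hi i a).fun_mul (hg a b)] at h0
    simp only [fun a => pd_mul c (hi i a) (hg a b), Finset.sum_add_distrib] at h0
    exact eq_neg_of_add_eq_zero_left h0
  calc pd c (fun y => ginv (g n) y i j) x
      = ∑ a, pd c (fun y => ginv (g n) y i a) x * ∑ b, g n x a b * ginv (g n) x b j := by
        simp [mul_ginv (H.metric n) hx]
    _ = ∑ b, (∑ a, pd c (fun y => ginv (g n) y i a) x * g n x a b) * ginv (g n) x b j := by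
        simp only [Finset.mul_sum, Finset.sum_mul]
        rw [Finset.sum_comm]
        exact Finset.sum_congr rfl fun a _ => Finset.sum_congr rfl fun b _ => by ring
    _ = _ := by
        simp only [h, neg_mul, Finset.sum_neg_distrib, Finset.sum_mul]
        rw [Finset.sum_comm]

end Bounds

end HighFrequency

end LimitingEinstein

namespace LimitingEinstein

section Algebra

variable {ι : Type*} [Fintype ι]

/-- Second-order part of the Ricci tensor, for a second-derivative array
`DD b a i j = ∂_b ∂_a g_ij`. -/
def ric2 (G : ι → ι → ℝ) (DD : ι → ι → ι → ι → ℝ) (m n : ι) : ℝ :=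
  ∑ a, ∑ b, G a b * (chr (DD b) m a n - chr (DD n) m a b)

/-- Quadratic first-order part of the Ricci tensor. -/
def ricq (G : ι → ι → ℝ) (D : ι → ι → ι → ℝ) (m n : ι) : ℝ :=
  ∑ a, ∑ b, ∑ s, ∑ r, G a b * G s r * (chr D n s a * chr D m r b - chr D a s b * chr D m r n)

/-- In wave gauge, the second-order part of the Ricci tensor is `-1/2` times the wave operator. -/
lemma ric2_eq {G : ι → ι → ℝ} {DD : ι → ι → ι → ι → ℝ} (Gs : ∀ a b, G a b = G b a)
    (hc : ∀ a b i j, DD a b i j = DD b a i j) (hs : ∀ a b i j, DD a b i j = DD a b j i) (m n : ι) :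
    ric2 G DD m n = -(1 / 2) * (∑ a, ∑ b, G a b * DD a b m n) +
      (1 / 2) * (gaugeD G (DD m) n + gaugeD G (DD n) m) := by
  have h : ∑ a, ∑ b, G a b * DD n a m b = ∑ a, ∑ b, G a b * DD n b m a := by
    rw [Finset.sum_comm]
    exact Finset.sum_congr rfl fun a _ => Finset.sum_congr rfl fun b _ => by rw [Gs]
  have h2 : ric2 G DD m n = -(1 / 2) * (∑ a, ∑ b, G a b * DD a b m n) +
      (1 / 2) * ((∑ a, ∑ b, G a b * (DD m b n a - (1 / 2) * DD m n a b)) +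
        (∑ a, ∑ b, G a b * (- (1 / 2) * DD n m a b))) +
        (1 / 2) * ∑ a, ∑ b, G a b * DD n a m b := by
    simp only [ric2, chr, Finset.mul_sum, ← Finset.sum_add_distrib]
    refine Finset.sum_congr rfl fun a _ => Finset.sum_congr rfl fun b _ => ?_
    rw [hc b m n a, hc b n m a, hc b a m n, hs n m b a, hc n m a b]
    ring
  rw [h2, h]
  simp only [gaugeD, Finset.mul_sum, ← Finset.sum_add_distrib]
  exact Finset.sum_congr rfl fun a _ => Finset.sum_congr rfl fun b _ => by ring

end Algebra

variable {d : ℕ} {O : Set (Vec d)} {g : Met d}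

lemma Hgauge_eq (g : Met d) (p : SymMat d) (r : Fin (d + 1)) (x : Vec d) :
    Hgauge g p r x = ∑ t, ginv g x r t * gaugeD (ginv g x) (dg p x) t := by
  simp only [Hgauge, gaugeD, Finset.mul_sum, dg]
  exact Finset.sum_congr rfl fun t _ => Finset.sum_congr rfl fun a _ =>
    Finset.sum_congr rfl fun b _ => by ring

lemma gaugeD_ginv_eq (hg : IsMetricOn g O) (p : SymMat d) {x : Vec d} (hx : x ∈ O)
    (t : Fin (d + 1)) :
    gaugeD (ginv g x) (dg p x) t = ∑ r, g x t r * Hgauge g p r x := by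
  simp only [Hgauge_eq, Finset.mul_sum]
  rw [Finset.sum_comm]
  simp only [← mul_assoc, ← Finset.sum_mul, mul_ginv hg hx]
  simp

lemma contDiffOn_dg (hO : IsOpen O) (hg : IsMetricOn g O) (a i j : Fin (d + 1)) :
    ContDiffOn ℝ (⊤ : ℕ∞) (fun x => dg g x a i j) O :=
  contDiffOn_pd hO (hg.1 i j) a

lemma contDiffOn_gaugeD (hO : IsOpen O) (hg : IsMetricOn g O) (t : Fin (d + 1)) :
    ContDiffOn ℝ (⊤ : ℕ∞) (fun x => gaugeD (ginv g x) (dg g x) t) O :=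
  ContDiffOn.sum fun a _ => ContDiffOn.sum fun b _ => (contDiffOn_ginv hg a b).mul
    ((contDiffOn_dg hO hg b t a).sub (contDiffOn_const.mul (contDiffOn_dg hO hg t a b)))

lemma contDiffOn_Hgauge (hO : IsOpen O) (hg : IsMetricOn g O) (r : Fin (d + 1)) :
    ContDiffOn ℝ (⊤ : ℕ∞) (Hgauge g g r) O := by
  simp only [funext (Hgauge_eq g g r)]
  exact ContDiffOn.sum fun t _ => (contDiffOn_ginv hg r t).mul (contDiffOn_gaugeD hO hg t)

lemma contDiffOn_chr (hO : IsOpen O) (hg : IsMetricOn g O) (a b c : Fin (d + 1)) :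
    ContDiffOn ℝ (⊤ : ℕ∞) (fun x => chr (dg g x) a b c) O :=
  contDiffOn_const.mul (((contDiffOn_dg hO hg a c b).add (contDiffOn_dg hO hg c a b)).sub
    (contDiffOn_dg hO hg b a c))

lemma RicciC_eq (hO : IsOpen O) (hg : IsMetricOn g O) {x : Vec d} (hx : x ∈ O)
    (m n : Fin (d + 1)) :
    RicciC g m n x = ric2 (ginv g x) (ddg g x) m n + ricq (ginv g x) (dg g x) m n := by
  have hd : ∀ a i j, DifferentiableAt ℝ (fun y => dg g y a i j) x := fun a i j =>
    ((contDiffOn_dg hO hg a i j).contDiffAt (hO.mem_nhds hx)).differentiableAt (by simp)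
  have h : ∀ e a b c, pd e (Christoffel g a b c) x = chr (ddg g x e) a b c := by
    intro e a b c
    have h1 : pd e (Christoffel g a b c) x =
        pd e (fun y => (1 / 2) * (dg g y a c b + dg g y c a b - dg g y b a c)) x := rfl
    rw [h1, pd_const_mul e _ (((hd a c b).fun_add (hd c a b)).fun_sub (hd b a c)),
      pd_sub e ((hd a c b).fun_add (hd c a b)) (hd b a c), pd_add e (hd a c b) (hd c a b)]
    rfl
  simp only [RicciC, h]
  rfl

lemma ddg_symm (hO : IsOpen O) (hg : IsMetricOn g O) {x : Vec d} (hx : x ∈ O)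
    (a b i j : Fin (d + 1)) : ddg g x a b i j = ddg g x a b j i :=
  pd_congr a hO hx fun _ hz => pd_congr b hO hz fun y hy => ((hg.2.1 y hy).apply i j).symm

lemma dg_symm (hO : IsOpen O) (hg : IsMetricOn g O) {x : Vec d} (hx : x ∈ O)
    (a i j : Fin (d + 1)) : dg g x a i j = dg g x a j i :=
  pd_congr a hO hx fun y hy => ((hg.2.1 y hy).apply i j).symm

namespace HighFrequency

variable {g0 : Met d} {g : ℕ → Met d} {lam s : ℕ → ℝ} {C : ℝ}
variable (H : HighFrequency O g0 g lam s C)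
include H

lemma Hgauge_seq_bdd (r : Fin (d + 1)) :
    UnifBdd O (fun p => Hgauge (g p.1) (g p.1) r p.2) := by
  simp only [Hgauge_eq]
  exact .sum fun t _ => (H.ginv_seq_bdd r t).bdd_mul <| .sum fun a _ => .sum fun b _ =>
    (H.ginv_seq_bdd a b).bdd_mul ((H.dg_seq_bdd b t a).sub ((H.dg_seq_bdd t a b).const_mul _))

lemma Hgauge_sub_unifO (r : Fin (d + 1)) :
    UnifO O s (fun p => Hgauge (g p.1) (g p.1) r p.2 - Hgauge g0 g0 r p.2) :=
  .of_le C (fun n => ((contDiffOn_Hgauge H.isOpen (H.metric n) r).continuousOn.sub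
      ((contDiffOn_Hgauge isOpen_univ H.limit r).continuousOn.mono (Set.subset_univ O))))
    (Eventually.of_forall fun n x hx => by
      rw [abs_of_pos ((H.lam_pos n).trans_le (H.lam_le n))]
      exact H.bound_gauge n x hx r)

/-- The perturbation satisfies the linearized wave gauge condition asymptotically. -/
lemma gaugeD_diff_unifO (t : Fin (d + 1)) :
    UnifO O s (fun p => gaugeD (ginv g0 p.2) (dg (hDiff g0 g p.1) p.2) t) := by
  have h1 : UnifO O s (fun p => ∑ r, hDiff g0 g p.1 p.2 t r * Hgauge (g p.1) (g p.1) r p.2) :=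
    UnifO.mono (.sum fun r _ => (H.diff_unifO t r).mul_bdd (H.Hgauge_seq_bdd r))
      H.lam_isBigO_gauge
  have h2 : UnifO O s (fun p =>
      ∑ r, g0 p.2 t r * (Hgauge (g p.1) (g p.1) r p.2 - Hgauge g0 g0 r p.2)) :=
    .sum fun r _ => (H.limit_bdd (H.contDiff_limit t r)).bdd_mul (H.Hgauge_sub_unifO r)
  have h3 : UnifO O s (fun p => ∑ a, ∑ b, (ginv (g p.1) p.2 a b - ginv g0 p.2 a b) *
      (dg (g p.1) p.2 b t a - (1 / 2) * dg (g p.1) p.2 t a b)) :=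
    UnifO.mono (.sum fun a _ => .sum fun b _ => (H.ginv_sub_unifO a b).mul_bdd
      ((H.dg_seq_bdd b t a).sub ((H.dg_seq_bdd t a b).const_mul _))) H.lam_isBigO_gauge
  refine ((h1.add h2).sub h3).congr fun n x hx => ?_
  have e1 := gaugeD_ginv_eq (H.metric n) (g n) hx t
  have e2 := gaugeD_ginv_eq H.limit g0 (Set.mem_univ x) t
  have e3 : gaugeD (ginv g0 x) (dg (hDiff g0 g n) x) t =
      gaugeD (ginv (g n) x) (dg (g n) x) t - gaugeD (ginv g0 x) (dg g0 x) t -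
      ∑ a, ∑ b, (ginv (g n) x a b - ginv g0 x a b) *
        (dg (g n) x b t a - (1 / 2) * dg (g n) x t a b) := by
    simp only [gaugeD, ← Finset.sum_sub_distrib]
    refine Finset.sum_congr rfl fun a _ => Finset.sum_congr rfl fun b _ => ?_
    rw [H.dg_seq n hx, H.dg_seq n hx]
    ring
  rw [e3, e1, e2]
  congr 1
  simp only [← Finset.sum_sub_distrib, ← Finset.sum_add_distrib]
  exact Finset.sum_congr rfl fun r _ => by rw [seq_eq_add_hDiff g0 g n x t r]; ring

lemma gaugeD_ddg_seq_bdd (m t : Fin (d + 1)) :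
    UnifBdd O (fun p => gaugeD (ginv (g p.1) p.2) (ddg (g p.1) p.2 m) t) := by
  have hpH : ∀ r, UnifBdd O (fun p => pd m (Hgauge (g p.1) (g p.1) r) p.2) := fun r =>
    .of_le C (fun n => (contDiffOn_pd H.isOpen
      (contDiffOn_Hgauge H.isOpen (H.metric n) r) m).continuousOn)
      (Eventually.of_forall fun n x hx => by simpa using H.bound_pd_gauge n x hx m r)
  have h1 : UnifBdd O (fun p => ∑ r, (dg (g p.1) p.2 m t r * Hgauge (g p.1) (g p.1) r p.2 +
      g p.1 p.2 t r * pd m (Hgauge (g p.1) (g p.1) r) p.2)) :=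
    .sum fun r _ => ((H.dg_seq_bdd m t r).bdd_mul (H.Hgauge_seq_bdd r)).add
      ((H.seq_bdd t r).bdd_mul (hpH r))
  have h2 : UnifBdd O (fun p => ∑ a, ∑ b, pd m (fun y => ginv (g p.1) y a b) p.2 *
      (dg (g p.1) p.2 b t a - (1 / 2) * dg (g p.1) p.2 t a b)) :=
    .sum fun a _ => .sum fun b _ => (H.pd_ginv_seq_bdd m a b).bdd_mul
      ((H.dg_seq_bdd b t a).sub ((H.dg_seq_bdd t a b).const_mul _))
  refine (h1.sub h2).congr fun n x hx => ?_
  have hG := fun a b => H.differentiableAt (contDiffOn_ginv (H.metric n) a b) hx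
  have hg := fun a b => H.differentiableAt ((H.metric n).1 a b) hx
  have hD := fun a i j => H.differentiableAt (contDiffOn_dg H.isOpen (H.metric n) a i j) hx
  have hH := fun r => H.differentiableAt (contDiffOn_Hgauge H.isOpen (H.metric n) r) hx
  have e := pd_congr m H.isOpen hx fun y hy => gaugeD_ginv_eq (H.metric n) (g n) hy t
  have e1 : pd m (fun y => ∑ r, g n y t r * Hgauge (g n) (g n) r y) x =
      ∑ r, (dg (g n) x m t r * Hgauge (g n) (g n) r x +
        g n x t r * pd m (Hgauge (g n) (g n) r) x) := by
    rw [pd_sum m (f := fun r y => g n y t r * Hgauge (g n) (g n) r y)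
      fun r _ => (hg t r).fun_mul (hH r)]
    exact Finset.sum_congr rfl fun r _ => pd_mul m (hg t r) (hH r)
  have hT := fun a b => (hD b t a).fun_sub ((hD t a b).const_mul (1 / 2))
  have e2 : pd m (fun y => gaugeD (ginv (g n) y) (dg (g n) y) t) x =
      ∑ a, ∑ b, (pd m (fun y => ginv (g n) y a b) x *
        (dg (g n) x b t a - (1 / 2) * dg (g n) x t a b) +
        ginv (g n) x a b * (ddg (g n) x m b t a - (1 / 2) * ddg (g n) x m t a b)) := by
    simp only [gaugeD]
    rw [pd_sum m (f := fun a y => ∑ b, ginv (g n) y a b *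
      (dg (g n) y b t a - (1 / 2) * dg (g n) y t a b))
      fun a _ => DifferentiableAt.fun_sum fun b _ => (hG a b).fun_mul (hT a b)]
    refine Finset.sum_congr rfl fun a _ => ?_
    rw [pd_sum m (f := fun b y => ginv (g n) y a b *
      (dg (g n) y b t a - (1 / 2) * dg (g n) y t a b))
      fun b _ => (hG a b).fun_mul (hT a b)]
    refine Finset.sum_congr rfl fun b _ => ?_
    rw [pd_mul m (hG a b) (hT a b), pd_sub m (hD b t a) ((hD t a b).const_mul (1 / 2)),
      pd_const_mul m _ (hD t a b)]
    rfl
  rw [e1, e2] at e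
  rw [← e]
  simp only [gaugeD, ← Finset.sum_sub_distrib]
  exact Finset.sum_congr rfl fun a _ => Finset.sum_congr rfl fun b _ => by ring

/-- The Einstein equations bound the wave operator of the perturbation. -/
lemma box_diff_bdd (m k : Fin (d + 1)) : UnifBdd O (fun p =>
    ∑ a, ∑ b, ginv g0 p.2 a b * ddg (hDiff g0 g p.1) p.2 a b m k) := by
  have hchr : ∀ a b c, UnifBdd O (fun p => chr (dg (g p.1) p.2) a b c) := fun a b c =>
    (((H.dg_seq_bdd a c b).add (H.dg_seq_bdd c a b)).sub (H.dg_seq_bdd b a c)).const_mul _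
  have h1 : UnifBdd O (fun p => ricq (ginv (g p.1) p.2) (dg (g p.1) p.2) m k) :=
    .sum fun a _ => .sum fun b _ => .sum fun s _ => .sum fun r _ =>
      ((H.ginv_seq_bdd a b).bdd_mul (H.ginv_seq_bdd s r)).bdd_mul
        (((hchr k s a).bdd_mul (hchr m r b)).sub ((hchr a s b).bdd_mul (hchr m r k)))
  have h2 := (H.gaugeD_ddg_seq_bdd m k).add (H.gaugeD_ddg_seq_bdd k m)
  have h3 : UnifBdd O (fun p => ∑ a, ∑ b, (ginv (g p.1) p.2 a b - ginv g0 p.2 a b) *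
      ddg (g p.1) p.2 a b m k) :=
    .sum fun a _ => .sum fun b _ => by
      simpa only [H.lam_inv_mul] using (H.ginv_sub_unifO a b).mul (H.ddg_seq_unifO a b m k)
  have h4 : UnifBdd O (fun p => ∑ a, ∑ b, ginv g0 p.2 a b * ddg g0 p.2 a b m k) :=
    .sum fun a _ => .sum fun b _ => (H.limit_bdd (H.contDiff_ginv_limit a b)).bdd_mul
      (H.limit_bdd (H.contDiff_ddg_limit a b m k))
  refine ((((h1.const_mul 2).add h2).sub h3).sub h4).congr fun n x hx => ?_
  have hM := H.metric n
  have e := H.ricci n x hx m k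
  rw [RicciC_eq H.isOpen hM hx, ric2_eq (DD := ddg (g n) x) (fun a b => ginv_symm hM hx a b)
    (fun a b i j => pd_comm H.isOpen (hM.1 i j) hx a b)
    (fun a b i j => ddg_symm H.isOpen hM hx a b i j)] at e
  have e2 : ∑ a, ∑ b, ginv g0 x a b * ddg (hDiff g0 g n) x a b m k =
      (∑ a, ∑ b, ginv (g n) x a b * ddg (g n) x a b m k) -
      (∑ a, ∑ b, (ginv (g n) x a b - ginv g0 x a b) * ddg (g n) x a b m k) -
      ∑ a, ∑ b, ginv g0 x a b * ddg g0 x a b m k := by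
    simp only [← Finset.sum_sub_distrib]
    refine Finset.sum_congr rfl fun a _ => Finset.sum_congr rfl fun b _ => ?_
    rw [H.ddg_seq n hx]
    ring
  rw [e2]
  linarith

end HighFrequency

end LimitingEinstein

namespace LimitingEinstein

namespace HighFrequency

variable {d : ℕ} {O : Set (Vec d)} {g0 : Met d} {g : ℕ → Met d} {lam s : ℕ → ℝ} {C : ℝ}
variable (H : HighFrequency O g0 g lam s C)
include H

lemma contDiff_chr_limit (a b c : Fin (d + 1)) :
    ContDiff ℝ (⊤ : ℕ∞) (fun x => chr (dg g0 x) a b c) :=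
  contDiffOn_univ.1 (contDiffOn_chr isOpen_univ H.limit a b c)

lemma contDiff_ginv_mul_ginv (a b i j : Fin (d + 1)) :
    ContDiff ℝ (⊤ : ℕ∞) (fun x => ginv g0 x a b * ginv g0 x i j) :=
  (H.contDiff_ginv_limit a b).mul (H.contDiff_ginv_limit i j)

lemma weakNull_dg_diff (a i j : Fin (d + 1)) :
    WeakNull O (fun p => dg (hDiff g0 g p.1) p.2 a i j) :=
  ((H.diff_unifO i j).weakNull H.lam_tendsto).pd H.isOpen a
    fun n => (H.contDiffOn_diff n i j).of_le (by norm_cast)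

lemma weakNull_ddg_diff (b a i j : Fin (d + 1)) :
    WeakNull O (fun p => ddg (hDiff g0 g p.1) p.2 b a i j) :=
  (H.weakNull_dg_diff a i j).pd H.isOpen b
    fun n => (H.contDiffOn_dg_diff n a i j).of_le (by norm_cast)

lemma weakNull_chr_dg_diff (a b c : Fin (d + 1)) :
    WeakNull O (fun p => chr (dg (hDiff g0 g p.1) p.2) a b c) :=
  ((((H.weakNull_dg_diff a c b).add H.isOpen (H.weakNull_dg_diff c a b)).sub H.isOpen
    (H.weakNull_dg_diff b a c)).const_mul _)

lemma weakNull_chr_ddg_diff (e a b c : Fin (d + 1)) :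
    WeakNull O (fun p => chr (ddg (hDiff g0 g p.1) p.2 e) a b c) :=
  ((((H.weakNull_ddg_diff e a c b).add H.isOpen (H.weakNull_ddg_diff e c a b)).sub H.isOpen
    (H.weakNull_ddg_diff e b a c)).const_mul _)

lemma chr_dg_diff_bdd (a b c : Fin (d + 1)) :
    UnifBdd O (fun p => chr (dg (hDiff g0 g p.1) p.2) a b c) :=
  (((H.dg_diff_bdd a c b).add (H.dg_diff_bdd c a b)).sub (H.dg_diff_bdd b a c)).const_mul _

lemma chr_ddg_diff_unifO (e a b c : Fin (d + 1)) :
    UnifO O (fun n => (lam n)⁻¹) (fun p => chr (ddg (hDiff g0 g p.1) p.2 e) a b c) :=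
  (((H.ddg_diff_unifO e a c b).add (H.ddg_diff_unifO e c a b)).sub
    (H.ddg_diff_unifO e b a c)).const_mul _

lemma chr_dg_seq_bdd (a b c : Fin (d + 1)) :
    UnifBdd O (fun p => chr (dg (g p.1) p.2) a b c) :=
  (((H.dg_seq_bdd a c b).add (H.dg_seq_bdd c a b)).sub (H.dg_seq_bdd b a c)).const_mul _

lemma chr_dg_seq (n : ℕ) {x : Vec d} (hx : x ∈ O) (a b c : Fin (d + 1)) :
    chr (dg (g n) x) a b c = chr (dg g0 x) a b c + chr (dg (hDiff g0 g n) x) a b c := by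
  simp only [chr, H.dg_seq n hx]
  ring

lemma chr_ddg_seq (n : ℕ) {x : Vec d} (hx : x ∈ O) (e a b c : Fin (d + 1)) :
    chr (ddg (g n) x e) a b c = chr (ddg g0 x e) a b c + chr (ddg (hDiff g0 g n) x e) a b c := by
  simp only [chr, H.ddg_seq n hx]
  ring

/-- Integration by parts in a product of first derivatives. -/
lemma weakNull_parts (b a i j k l : Fin (d + 1)) : WeakNull O (fun p =>
    dg (hDiff g0 g p.1) p.2 b i j * dg (hDiff g0 g p.1) p.2 a k l +
      hDiff g0 g p.1 p.2 i j * ddg (hDiff g0 g p.1) p.2 b a k l) := by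
  have h := (((H.diff_unifO i j).mul_bdd (H.dg_diff_bdd a k l)).weakNull H.lam_tendsto).pd
    H.isOpen b fun n => ((H.contDiffOn_diff n i j).mul (H.contDiffOn_dg_diff n a k l)).of_le
      (by norm_cast)
  exact h.congr fun n x hx => (pd_mul b (H.differentiableAt (H.contDiffOn_diff n i j) hx)
    (H.differentiableAt (H.contDiffOn_dg_diff n a k l) hx)).symm

lemma weakNull_parts_chr (e i j a b c : Fin (d + 1)) : WeakNull O (fun p =>
    dg (hDiff g0 g p.1) p.2 e i j * chr (dg (hDiff g0 g p.1) p.2) a b c +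
      hDiff g0 g p.1 p.2 i j * chr (ddg (hDiff g0 g p.1) p.2 e) a b c) := by
  refine ((((H.weakNull_parts e a i j c b).add H.isOpen (H.weakNull_parts e c i j a b)).sub H.isOpen
    (H.weakNull_parts e b i j a c)).const_mul (1 / 2)).congr fun n x _ => ?_
  simp only [chr]
  ring

/-- The null forms `G^{ab} ∂_a h_ij ∂_b h_kl` vanish weakly, by the wave equation. -/
lemma weakNull_nullD (i j k l : Fin (d + 1)) :
    WeakNull O (fun p => nullD (ginv g0 p.2) (dg (hDiff g0 g p.1) p.2) i j k l) := by
  refine WeakNull.congr (.sub H.isOpen (.sum (s := Finset.univ) H.isOpen fun a _ =>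
      .sum (s := Finset.univ) H.isOpen fun b _ =>
      (H.weakNull_parts a b i j k l).smooth_mul (H.contDiff_ginv_limit a b))
    (((H.diff_unifO i j).mul_bdd (H.box_diff_bdd k l)).weakNull H.lam_tendsto)) fun n x _ => ?_
  simp only [nullD, Finset.mul_sum, ← Finset.sum_sub_distrib]
  exact Finset.sum_congr rfl fun a _ => Finset.sum_congr rfl fun b _ => by ring

lemma ric2_ginv_sub_limit_unifO (m k : Fin (d + 1)) : UnifO O lam (fun p =>
    ric2 (fun a b => ginv (g p.1) p.2 a b - ginv g0 p.2 a b) (ddg g0 p.2) m k) := by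
  have h : ∀ e a b c, UnifBdd O (fun p => chr (ddg g0 p.2 e) a b c) := fun e a b c =>
    H.limit_bdd (contDiff_const.mul (((H.contDiff_ddg_limit e a c b).add
      (H.contDiff_ddg_limit e c a b)).sub (H.contDiff_ddg_limit e b a c)))
  exact .sum fun a _ => .sum fun b _ => (H.ginv_sub_unifO a b).mul_bdd ((h b m a k).sub (h k m a b))

lemma ric2_ginv_expansion_unifO (m k : Fin (d + 1)) : UnifO O lam (fun p =>
    ric2 (fun a b => ginv (g p.1) p.2 a b - ginv g0 p.2 a b +
      ∑ i, ∑ j, ginv g0 p.2 a i * hDiff g0 g p.1 p.2 i j * ginv g0 p.2 j b)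
      (ddg (hDiff g0 g p.1) p.2) m k) := by
  have h : (fun n => lam n * lam n * (lam n)⁻¹) = lam :=
    funext fun n => mul_inv_cancel_right₀ (H.lam_pos n).ne' _
  refine .sum fun a _ => .sum fun b _ => ?_
  simpa only [h] using (H.ginv_expansion a b).mul
    ((H.chr_ddg_diff_unifO b m a k).sub (H.chr_ddg_diff_unifO k m a b))

lemma weakNull_ric2 (m k : Fin (d + 1)) :
    WeakNull O (fun p => ric2 (ginv g0 p.2) (ddg (hDiff g0 g p.1) p.2) m k) :=
  .sum H.isOpen fun a _ => .sum H.isOpen fun b _ => .smooth_mul (H.contDiff_ginv_limit a b)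
    ((H.weakNull_chr_ddg_diff b m a k).sub H.isOpen (H.weakNull_chr_ddg_diff k m a b))

lemma ricq_ginv_sub_unifO (m k : Fin (d + 1)) : UnifO O lam (fun p =>
    ricq (ginv (g p.1) p.2) (dg (g p.1) p.2) m k -
      ricq (ginv g0 p.2) (dg (g p.1) p.2) m k) := by
  have h : UnifO O lam (fun p => ∑ a, ∑ b, ∑ t, ∑ r,
      ((ginv (g p.1) p.2 a b - ginv g0 p.2 a b) * ginv (g p.1) p.2 t r +
        ginv g0 p.2 a b * (ginv (g p.1) p.2 t r - ginv g0 p.2 t r)) *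
      (chr (dg (g p.1) p.2) k t a * chr (dg (g p.1) p.2) m r b -
        chr (dg (g p.1) p.2) a t b * chr (dg (g p.1) p.2) m r k)) :=
    .sum fun a _ => .sum fun b _ => .sum fun t _ => .sum fun r _ =>
      (((H.ginv_sub_unifO a b).mul_bdd (H.ginv_seq_bdd t r)).add
        ((H.limit_bdd (H.contDiff_ginv_limit a b)).bdd_mul (H.ginv_sub_unifO t r))).mul_bdd
        (((H.chr_dg_seq_bdd k t a).bdd_mul (H.chr_dg_seq_bdd m r b)).sub
          ((H.chr_dg_seq_bdd a t b).bdd_mul (H.chr_dg_seq_bdd m r k)))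
  refine h.congr fun n x _ => ?_
  simp only [ricq, ← Finset.sum_sub_distrib]
  exact sum_congr₄ fun a b t r => by ring

lemma weakNull_ricq_cross (m k : Fin (d + 1)) : WeakNull O (fun p =>
    ricq (ginv g0 p.2) (dg (g p.1) p.2) m k - ricq (ginv g0 p.2) (dg g0 p.2) m k -
      ricq (ginv g0 p.2) (dg (hDiff g0 g p.1) p.2) m k) := by
  have hΓ : ∀ i j e a b c, WeakNull O (fun p => chr (dg g0 p.2) i j e *
      chr (dg (hDiff g0 g p.1) p.2) a b c) := fun i j e a b c =>
    (H.weakNull_chr_dg_diff a b c).smooth_mul (H.contDiff_chr_limit i j e)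
  refine WeakNull.congr (.sum (s := Finset.univ) H.isOpen fun a _ =>
    .sum (s := Finset.univ) H.isOpen fun b _ => .sum (s := Finset.univ) H.isOpen fun t _ =>
    .sum (s := Finset.univ) H.isOpen fun r _ => .smooth_mul (H.contDiff_ginv_mul_ginv a b t r)
    (((hΓ k t a m r b).add H.isOpen (hΓ m r b k t a)).sub H.isOpen
      ((hΓ a t b m r k).add H.isOpen (hΓ m r k a t b)))) fun n x hx => ?_
  simp only [ricq, ← Finset.sum_sub_distrib, H.chr_dg_seq n hx]
  exact sum_congr₄ fun a b t r => by ring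

lemma weakNull_quad_parts (m k : Fin (d + 1)) : WeakNull O (fun p =>
    ric2 (fun a b => ∑ i, ∑ j, ginv g0 p.2 a i * hDiff g0 g p.1 p.2 i j * ginv g0 p.2 j b)
      (ddg (hDiff g0 g p.1) p.2) m k +
    (quadD (ginv g0 p.2) (dg (hDiff g0 g p.1) p.2) m k -
      ricq (ginv g0 p.2) (dg (hDiff g0 g p.1) p.2) m k)) := by
  refine WeakNull.congr (.sum (s := Finset.univ) H.isOpen fun a _ =>
    .sum (s := Finset.univ) H.isOpen fun b _ => .sum (s := Finset.univ) H.isOpen fun i _ =>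
    .sum (s := Finset.univ) H.isOpen fun j _ => .smooth_mul (H.contDiff_ginv_mul_ginv a i b j)
    ((H.weakNull_parts_chr b i j m a k).sub H.isOpen (H.weakNull_parts_chr k i j m a b)))
    fun n x _ => ?_
  simp only [ric2, quadD, ricq, Finset.sum_mul, ← Finset.sum_add_distrib,
    ← Finset.sum_sub_distrib]
  exact sum_congr₄ fun a b i j => by rw [ginv_symm H.limit (Set.mem_univ x) j b]; ring

lemma weakNull_ricci_add_quadD (m k : Fin (d + 1)) : WeakNull O (fun p =>
    RicciC g0 m k p.2 + quadD (ginv g0 p.2) (dg (hDiff g0 g p.1) p.2) m k) := by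
  refine WeakNull.congr (.sub H.isOpen (.sub H.isOpen (.sub H.isOpen (.sub H.isOpen
    (.sub H.isOpen (H.weakNull_quad_parts m k)
      ((H.ric2_ginv_sub_limit_unifO m k).weakNull H.lam_tendsto))
      (H.weakNull_ric2 m k))
      ((H.ric2_ginv_expansion_unifO m k).weakNull H.lam_tendsto))
      ((H.ricq_ginv_sub_unifO m k).weakNull H.lam_tendsto))
      (H.weakNull_ricq_cross m k)) fun n x hx => ?_
  have e := H.ricci n x hx m k
  rw [RicciC_eq H.isOpen (H.metric n) hx] at e
  have h : ric2 (ginv (g n) x) (ddg (g n) x) m k =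
      ric2 (ginv g0 x) (ddg g0 x) m k +
      ric2 (fun a b => ginv (g n) x a b - ginv g0 x a b) (ddg g0 x) m k +
      ric2 (ginv g0 x) (ddg (hDiff g0 g n) x) m k +
      ric2 (fun a b => ginv (g n) x a b - ginv g0 x a b +
        ∑ i, ∑ j, ginv g0 x a i * hDiff g0 g n x i j * ginv g0 x j b)
        (ddg (hDiff g0 g n) x) m k -
      ric2 (fun a b => ∑ i, ∑ j, ginv g0 x a i * hDiff g0 g n x i j * ginv g0 x j b)
        (ddg (hDiff g0 g n) x) m k := by
    simp only [ric2, H.chr_ddg_seq n hx, ← Finset.sum_add_distrib, ← Finset.sum_sub_distrib]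
    exact Finset.sum_congr rfl fun a _ => Finset.sum_congr rfl fun b _ => by ring
  rw [RicciC_eq isOpen_univ H.limit (Set.mem_univ x)]
  simp only
  linarith

/-- The weak limit of the quadratic terms, in terms of trace and full contraction. -/
lemma weakNull_ricci (m k : Fin (d + 1)) : WeakNull O (fun p => RicciC g0 m k p.2 +
    ((1 / 8) * (trD (ginv g0 p.2) (dg (hDiff g0 g p.1) p.2) m *
      trD (ginv g0 p.2) (dg (hDiff g0 g p.1) p.2) k) -
    (1 / 4) * sqD (ginv g0 p.2) (dg (hDiff g0 g p.1) p.2) m k)) := by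
  have hO := H.isOpen
  have hG := fun a b => H.limit_bdd (H.contDiff_ginv_limit a b)
  have hQ := H.gaugeD_diff_unifO
  have hT : ∀ t, UnifBdd O (fun p => trD (ginv g0 p.2) (dg (hDiff g0 g p.1) p.2) t) := fun t =>
    .sum fun a _ => .sum fun b _ => (hG a b).bdd_mul (H.dg_diff_bdd t a b)
  have hQb : ∀ t, UnifBdd O (fun p => gaugeD (ginv g0 p.2) (dg (hDiff g0 g p.1) p.2) t) := fun t =>
    .sum fun a _ => .sum fun b _ => (hG a b).bdd_mul
      ((H.dg_diff_bdd b t a).sub ((H.dg_diff_bdd t a b).const_mul _))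
  have h1 : UnifO O s (fun p => ∑ a, ∑ b, ginv g0 p.2 a b *
      (gaugeD (ginv g0 p.2) (dg (hDiff g0 g p.1) p.2) b *
        chr (dg (hDiff g0 g p.1) p.2) m a k)) :=
    .sum fun a _ => .sum fun b _ => (hG a b).bdd_mul ((hQ b).mul_bdd (H.chr_dg_diff_bdd m a k))
  have h2 : UnifO O s (fun p => ∑ t, ∑ r, ginv g0 p.2 t r *
      (gaugeD (ginv g0 p.2) (dg (hDiff g0 g p.1) p.2) t *
        chr (dg (hDiff g0 g p.1) p.2) m r k)) :=
    .sum fun t _ => .sum fun r _ => (hG t r).bdd_mul ((hQ t).mul_bdd (H.chr_dg_diff_bdd m r k))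
  have h3 := (((hT m).bdd_mul (hQ k)).add ((hT k).bdd_mul (hQ m))).const_mul (1 / 4)
  have h4 := ((((hQb k).bdd_mul (hQ m)).add (((hT k).bdd_mul (hQ m)).const_mul (1 / 2))).add
    (((hT m).bdd_mul (hQ k)).const_mul (1 / 2))).const_mul (1 / 2)
  have hgauge := (((h1.sub h2).add h3).sub h4).weakNull H.gauge_tendsto
  have h5 : ∀ i j, WeakNull O (fun p => ∑ a, ∑ b, ∑ t, ∑ r, ginv g0 p.2 a b * ginv g0 p.2 t r *
      commD (dg (hDiff g0 g p.1) p.2) b i t r j a) := fun i j =>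
    .sum hO fun a _ => .sum hO fun b _ => .sum hO fun t _ => .sum hO fun r _ =>
      (H.comm b i t r j a).smooth_mul (H.contDiff_ginv_mul_ginv a b t r)
  have h5' : WeakNull O (fun p => ∑ a, ∑ b, ∑ t, ∑ r, ginv g0 p.2 a b * ginv g0 p.2 t r *
      commD (dg (hDiff g0 g p.1) p.2) b k t r m a) := h5 k m
  have h6 : WeakNull O (fun p => ∑ a, ∑ b, ∑ t, ∑ r, ginv g0 p.2 a b * ginv g0 p.2 t r *
      commD (dg (hDiff g0 g p.1) p.2) a r k t m b) :=
    .sum hO fun a _ => .sum hO fun b _ => .sum hO fun t _ => .sum hO fun r _ =>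
      (H.comm a r k t m b).smooth_mul (H.contDiff_ginv_mul_ginv a b t r)
  have h7 : WeakNull O (fun p => ∑ i, ∑ j, ginv g0 p.2 i j *
      nullD (ginv g0 p.2) (dg (hDiff g0 g p.1) p.2) i j m k) :=
    .sum hO fun i _ => .sum hO fun j _ =>
      (H.weakNull_nullD i j m k).smooth_mul (H.contDiff_ginv_limit i j)
  have h8 : WeakNull O (fun p => ∑ t, ∑ r, ginv g0 p.2 t r *
      nullD (ginv g0 p.2) (dg (hDiff g0 g p.1) p.2) k t m r) :=
    .sum hO fun t _ => .sum hO fun r _ =>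
      (H.weakNull_nullD k t m r).smooth_mul (H.contDiff_ginv_limit t r)
  refine ((H.weakNull_ricci_add_quadD m k).sub hO
    ((((hgauge.add hO (((h5 m k).add hO h5').const_mul (1 / 4))).sub hO
      (h6.const_mul (1 / 2))).sub hO (h7.const_mul (1 / 4))).add hO
      (h8.const_mul (1 / 2)))).congr fun n x hx => ?_
  have hDs : ∀ a i j, dg (hDiff g0 g n) x a i j = dg (hDiff g0 g n) x a j i := by
    intro a i j
    have e1 := H.dg_seq n hx a i j
    have e2 := H.dg_seq n hx a j i
    have e3 := dg_symm H.isOpen (H.metric n) hx a i j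
    have e4 := dg_symm isOpen_univ H.limit (Set.mem_univ x) a i j
    linarith
  simp only
  rw [quadD_eq (ginv g0 x) (dg (hDiff g0 g n) x)
    (fun a b => ginv_symm H.limit (Set.mem_univ x) a b) hDs]
  ring

end HighFrequency

end LimitingEinstein

namespace LimitingEinstein

lemma trD_mul_trD {ι : Type*} [Fintype ι] {G : ι → ι → ℝ} (Gs : ∀ a b, G a b = G b a)
    (D : ι → ι → ι → ℝ) (m n : ι) :
    trD G D m * trD G D n = ∑ a, ∑ b, ∑ r, ∑ s, G a r * G b s * (D m r a * D n b s) := by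
  have h : trD G D m = ∑ a, ∑ r, G a r * D m r a := by
    rw [trD, Finset.sum_comm]
    exact Finset.sum_congr rfl fun a _ => Finset.sum_congr rfl fun b _ => by rw [Gs]
  rw [h, sum_comm_mid]
  simp only [trD, Finset.sum_mul, Finset.mul_sum]
  rw [sum_comm_pairs]
  exact sum_congr₄ fun a b r s => by ring

variable {d : ℕ}

/-- Convergence of the integrals of a sequence of integrable functions. -/
def IntLim (F : ℕ → Vec d → ℝ) (L : ℝ) : Prop :=
  (∀ n, Integrable (F n)) ∧ Tendsto (fun n => ∫ x, F n x) atTop (𝓝 L)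

namespace IntLim

variable {F F' : ℕ → Vec d → ℝ} {L L' : ℝ}

lemma const_mul (c : ℝ) (h : IntLim F L) : IntLim (fun n x => c * F n x) (c * L) :=
  ⟨fun n => (h.1 n).const_mul c, by simpa only [integral_const_mul] using h.2.const_mul c⟩

lemma add (h : IntLim F L) (h' : IntLim F' L') : IntLim (fun n x => F n x + F' n x) (L + L') :=
  ⟨fun n => (h.1 n).add (h'.1 n),
    (h.2.add h'.2).congr fun n => (integral_add (h.1 n) (h'.1 n)).symm⟩

lemma sub (h : IntLim F L) (h' : IntLim F' L') : IntLim (fun n x => F n x - F' n x) (L - L') :=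
  ⟨fun n => (h.1 n).sub (h'.1 n),
    (h.2.sub h'.2).congr fun n => (integral_sub (h.1 n) (h'.1 n)).symm⟩

lemma sum {ι : Type*} {s : Finset ι} {F : ι → ℕ → Vec d → ℝ} {L : ι → ℝ}
    (h : ∀ i ∈ s, IntLim (F i) (L i)) :
    IntLim (fun n x => ∑ i ∈ s, F i n x) (∑ i ∈ s, L i) :=
  ⟨fun n => integrable_finsetSum s fun i hi => (h i hi).1 n,
    (tendsto_finsetSum s fun i hi => (h i hi).2).congr fun n =>
      (integral_finsetSum s fun i hi => (h i hi).1 n).symm⟩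

end IntLim

/-- The density of the volume form of a metric. -/
def volDensity (g : Met d) (x : Vec d) : ℝ := Real.sqrt |(g x).det|

lemma volDensity_pos {g : Met d} (hg : IsMetricOn g Set.univ) (x : Vec d) :
    0 < volDensity g x :=
  Real.sqrt_pos.2 (abs_pos.2 (hg.2.2 x (Set.mem_univ x)).ne_zero)

lemma contDiff_volDensity {g : Met d} (hg : IsMetricOn g Set.univ) :
    ContDiff ℝ (⊤ : ℕ∞) (volDensity g) := by
  have h0 : ∀ x, (g x).det ≠ 0 := fun x => (hg.2.2 x (Set.mem_univ x)).ne_zero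
  exact ((contDiffOn_univ.1 (contDiffOn_det hg.1)).abs h0).sqrt fun x => abs_ne_zero.2 (h0 x)

lemma pd_cutoff_mul {O : Set (Vec d)} (hO : IsOpen O) {χ f : Vec d → ℝ} (hχ : ∀ x ∈ O, χ x = 1)
    (a : Fin (d + 1)) {x : Vec d} (hx : x ∈ O) : pd a (fun y => χ y * f y) x = pd a f x :=
  pd_congr a hO hx fun y hy => by rw [hχ y hy, one_mul]

lemma contDiff_mul_of_tsupport_subset {U : Set (Vec d)} (hU : IsOpen U) {χ f : Vec d → ℝ}
    (hχ : ContDiff ℝ (⊤ : ℕ∞) χ) (hs : tsupport χ ⊆ U) (hf : ContDiffOn ℝ (⊤ : ℕ∞) f U) :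
    ContDiff ℝ (⊤ : ℕ∞) (fun x => χ x * f x) :=
  contDiff_iff_contDiffAt.2 fun x => by
    by_cases hx : x ∈ tsupport χ
    · exact hχ.contDiffAt.mul (hf.contDiffAt (hU.mem_nhds (hs hx)))
    · refine (contDiffAt_const (c := (0 : ℝ))).congr_of_eventuallyEq ?_
      filter_upwards [notMem_tsupport_iff_eventuallyEq.1 hx] with y hy
      rw [hy, Pi.zero_apply, zero_mul]

/-- The pairing with trivial multiplier is a real integral on which the cutoff is invisible. -/
lemma pairG_Tm_one {U O : Set (Vec d)} (hU : IsOpen U) (hO : IsOpen O) (g0 : Met d)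
    {χ p q f : Vec d → ℝ} (hχ : ContDiff ℝ (⊤ : ℕ∞) χ) (hc : HasCompactSupport χ)
    (hs : tsupport χ ⊆ U) (hχO : ∀ x ∈ O, χ x = 1) (hq : ContDiffOn ℝ (⊤ : ℕ∞) q U)
    (hf : tsupport f ⊆ O) (a b : Fin (d + 1)) :
    pairG g0 (fun x => ((pd a (fun y => χ y * p y) x : ℝ) : ℂ))
      (fun x => ((f x : ℝ) : ℂ) *
        Tm (fun _ => 1) (fun y => ((pd b (fun z => χ z * q z) y : ℝ) : ℂ)) x) =
      ((∫ x, f x * volDensity g0 x * (pd a p x * pd b q x) : ℝ) : ℂ) := by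
  have h1 : ContDiff ℝ (⊤ : ℕ∞) (fun y => ((pd b (fun z => χ z * q z) y : ℝ) : ℂ)) :=
    Complex.ofRealCLM.contDiff.comp (contDiffOn_univ.1 (contDiffOn_pd isOpen_univ
      (contDiff_mul_of_tsupport_subset hU hχ hs hq).contDiffOn b))
  have h2 : HasCompactSupport (fun y => ((pd b (fun z => χ z * q z) y : ℝ) : ℂ)) := by
    have h := (hc.mul_right (f' := q)).fderiv_apply ℝ (Pi.single b (1 : ℝ))
    exact h.comp_left (g := Complex.ofReal) Complex.ofReal_zero
  rw [Tm_one h1 h2, pairG, ← integral_complex_ofReal]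
  refine integral_congr_ae (Eventually.of_forall fun x => ?_)
  by_cases hx : x ∈ O
  · simp only [pd_cutoff_mul hO hχO _ hx, Complex.conj_ofReal, volDensity]
    push_cast
    ring
  · simp [image_eq_zero_of_notMem_tsupport fun hx' => hx (hf hx')]

end LimitingEinstein

namespace LimitingEinstein

variable {d : ℕ} {O : Set (Vec d)} {g0 : Met d} {g : ℕ → Met d}

/-- Tested quadratic expressions in first derivatives whose limits are symmetric in the
derivative indices have weakly null commutators. -/
lemma weakNull_commD (hg0 : IsMetricOn g0 Set.univ)
    (hD : ∀ n a i j, ContDiffOn ℝ (⊤ : ℕ∞) (fun x => dg (hDiff g0 g n) x a i j) O)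
    {i j k l : Fin (d + 1)} {L : (Vec d → ℝ) → Fin (d + 1) → Fin (d + 1) → ℝ}
    (hL : ∀ f a b, L f a b = L f b a)
    (h : ∀ a b f, ContDiff ℝ (⊤ : ℕ∞) f → HasCompactSupport f → tsupport f ⊆ O →
      IntLim (fun n x => f x * volDensity g0 x *
        (dg (hDiff g0 g n) x a i j * dg (hDiff g0 g n) x b k l)) (L f a b))
    (a b : Fin (d + 1)) :
    WeakNull O fun p => commD (dg (hDiff g0 g p.1) p.2) a b i j k l := by
  refine ⟨fun n => (((hD n a i j).mul (hD n b k l)).sub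
    ((hD n b i j).mul (hD n a k l))).continuousOn, fun ψ h1 h2 h3 => ?_⟩
  have hw := volDensity_pos hg0
  have hinv : ContDiff ℝ (⊤ : ℕ∞) (fun x => (volDensity g0 x)⁻¹) :=
    (contDiff_volDensity hg0).inv fun x => (hw x).ne'
  have hf := fun a b => h a b (fun x => ψ x * (volDensity g0 x)⁻¹) (h1.mul hinv) h2.mul_right
    ((closure_mono (Function.support_mul_subset_left _ _)).trans h3)
  have hlim := ((hf a b).sub (hf b a)).2
  rw [hL _ a b, sub_self] at hlim
  refine hlim.congr fun n => integral_congr_ae (Eventually.of_forall fun x => ?_)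
  simp only [commD, inv_mul_cancel_right₀ (hw x).ne']
  ring

/-- The limiting Einstein equation, in terms of the limits `L` of tested quadratic expressions in
the first derivatives of the perturbation. -/
lemma HighFrequency.integral_ricci {lam s : ℕ → ℝ} {C : ℝ}
    (H : HighFrequency O g0 g lam s C)
    {L : Fin (d + 1) → Fin (d + 1) → Fin (d + 1) → Fin (d + 1) → (Vec d → ℝ) →
      Fin (d + 1) → Fin (d + 1) → ℝ}
    (h : ∀ i j k l a b f, ContDiff ℝ (⊤ : ℕ∞) f → HasCompactSupport f → tsupport f ⊆ O →
      IntLim (fun n x => f x * volDensity g0 x *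
        (dg (hDiff g0 g n) x a i j * dg (hDiff g0 g n) x b k l)) (L i j k l f a b))
    (m k : Fin (d + 1)) {ψ : Vec d → ℝ} (h1 : ContDiff ℝ (⊤ : ℕ∞) ψ) (h2 : HasCompactSupport ψ)
    (h3 : tsupport ψ ⊆ O) :
    ∫ x, ψ x * RicciC g0 m k x * volDensity g0 x =
      ∑ a, ∑ b, ∑ r, ∑ t,
        ((1 / 4) * L r b a t (fun x => ginv g0 x a r * ginv g0 x b t * ψ x) m k -
          (1 / 8) * L r a b t (fun x => ginv g0 x a r * ginv g0 x b t * ψ x) m k) := by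
  have hw := contDiff_volDensity H.limit
  have hlim := fun i j i' j' a b r t => h i j i' j' m k
    (fun x => ginv g0 x a r * ginv g0 x b t * ψ x)
    ((H.contDiff_ginv_mul_ginv a r b t).mul h1) h2.mul_left
    ((closure_mono (Function.support_mul_subset_right _ _)).trans h3)
  have hquad := IntLim.sum (s := Finset.univ) fun a _ => IntLim.sum (s := Finset.univ) fun b _ =>
    IntLim.sum (s := Finset.univ) fun r _ => IntLim.sum (s := Finset.univ) fun t _ =>
      ((hlim r b a t a b r t).const_mul (1 / 4)).sub ((hlim r a b t a b r t).const_mul (1 / 8))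
  have hR := H.weakNull_ricci m k
  have hsupp : tsupport (fun x => ψ x * volDensity g0 x) ⊆ O :=
    (closure_mono (Function.support_mul_subset_left _ _)).trans h3
  have hzero : IntLim (fun n x => ψ x * volDensity g0 x * (RicciC g0 m k x +
      ((1 / 8) * (trD (ginv g0 x) (dg (hDiff g0 g n) x) m *
        trD (ginv g0 x) (dg (hDiff g0 g n) x) k) -
      (1 / 4) * sqD (ginv g0 x) (dg (hDiff g0 g n) x) m k))) 0 :=
    ⟨fun n => integrable_mul_of_tsupport_subset H.isOpen (h1.mul hw).continuous h2.mul_right hsupp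
      (hR.1 n), hR.2 _ (h1.mul hw) h2.mul_right hsupp⟩
  have htot := (hzero.add hquad).2
  rw [zero_add] at htot
  refine tendsto_nhds_unique (tendsto_const_nhds.congr fun n => ?_) htot
  refine integral_congr_ae (Eventually.of_forall fun x => ?_)
  have e : ∑ a, ∑ b, ∑ r, ∑ t,
      ((1 / 4) * (ginv g0 x a r * ginv g0 x b t * ψ x * volDensity g0 x *
        (dg (hDiff g0 g n) x m r b * dg (hDiff g0 g n) x k a t)) -
      (1 / 8) * (ginv g0 x a r * ginv g0 x b t * ψ x * volDensity g0 x *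
        (dg (hDiff g0 g n) x m r a * dg (hDiff g0 g n) x k b t))) =
      ψ x * volDensity g0 x * ((1 / 4) * sqD (ginv g0 x) (dg (hDiff g0 g n) x) m k -
        (1 / 8) * (trD (ginv g0 x) (dg (hDiff g0 g n) x) m *
        trD (ginv g0 x) (dg (hDiff g0 g n) x) k)) := by
    rw [trD_mul_trD (fun a b => ginv_symm H.limit (Set.mem_univ x) a b)]
    simp only [sqD, Finset.mul_sum, ← Finset.sum_sub_distrib]
    exact sum_congr₄ fun a b r t => by ring
  simp only [e]
  ring

end LimitingEinstein

/-- Limiting Einstein equation. -/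
theorem stmt1
    (d : ℕ) (hd : 3 ≤ d)
    (U : Set (Vec d)) (hUo : IsOpen U) (hUb : Bornology.IsBounded U)
    -- (i) the limiting metric
    (g0 : Met d) (hg0 : IsMetricOn g0 Set.univ)
    (hg0b : ∀ (α β : Fin (d + 1)) (k : ℕ), ∃ C : ℝ, ∀ x,
      ‖iteratedFDeriv ℝ k (fun y => g0 y α β) x‖ ≤ C)
    (hg0ib : ∀ (α β : Fin (d + 1)) (k : ℕ), ∃ C : ℝ, ∀ x,
      ‖iteratedFDeriv ℝ k (fun y => ginv g0 y α β) x‖ ≤ C)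
    (hg0n : ∀ x, ∀ α β : Fin (d + 1), |g0 x α β - mink d α β| ≤ ((10 : ℝ) ^ (100 : ℕ))⁻¹ ∧
      |ginv g0 x α β - mink d α β| ≤ ((10 : ℝ) ^ (100 : ℕ))⁻¹)
    -- (ii) the high-frequency sequence of Ricci-flat metrics
    (lam : ℕ → ℝ) (hlam1 : ∀ n, lam n ∈ Set.Ioo (0 : ℝ) 1) (hlam2 : Antitone lam)
    (hlam3 : Tendsto lam atTop (𝓝 0))
    (g : ℕ → Met d) (hg : ∀ n, IsMetricOn (g n) U)
    (hric : ∀ n, ∀ x ∈ U, ∀ μ ν : Fin (d + 1), RicciC (g n) μ ν x = 0)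
    -- (iii) the quantitative high-frequency and generalized wave coordinate bounds
    (C : ℝ) (hC : 0 < C) (eta : ℝ) (heta : eta ∈ Set.Ioc (0 : ℝ) 1)
    (hb0 : ∀ n, ∀ x ∈ U, ∀ α β : Fin (d + 1), |g n x α β - g0 x α β| ≤ lam n)
    (hb1 : ∀ n, ∀ x ∈ U, ∀ γ α β : Fin (d + 1),
      |pd γ (fun y => g n y α β - g0 y α β) x| ≤ C)
    (hb2 : ∀ n, ∀ x ∈ U, ∀ γ δ α β : Fin (d + 1),
      |pd δ (pd γ (fun y => g n y α β - g0 y α β)) x| ≤ C * (lam n)⁻¹)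
    (hb3 : ∀ n, ∀ x ∈ U, ∀ α : Fin (d + 1),
      |Hgauge (g n) (g n) α x - Hgauge g0 g0 α x| ≤ C * lam n ^ eta)
    (hb4 : ∀ n, ∀ x ∈ U, ∀ γ α : Fin (d + 1), |pd γ (Hgauge (g n) (g n) α) x| ≤ C)
    -- (iv) the cutoff
    (K : Set (Vec d)) (hK : IsCompact K) (hKU : K ⊆ U)
    (χ : Vec d → ℝ) (hχ1 : ContDiff ℝ (⊤ : ℕ∞) χ) (hχ2 : HasCompactSupport χ)
    (hχ3 : tsupport χ ⊆ U) (hχ4 : ∃ V, IsOpen V ∧ K ⊆ V ∧ ∀ x ∈ V, χ x = 1)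
    -- the microlocal defect measures
    (μm : Fin (d + 1) → Fin (d + 1) → Fin (d + 1) → Fin (d + 1) →
      MeasureTheory.SignedMeasure (Phase d))
    (hμ1 : ∀ α β ρ σ, μm α β ρ σ = μm ρ σ α β) (hμ2 : ∀ α β ρ σ, μm α β ρ σ = μm β α ρ σ)
    (hμ3 : ∀ α β ρ σ, ∀ s : Set (Phase d), MeasurableSet s →
      s ∩ (U ×ˢ usphere d) = ∅ → μm α β ρ σ s = 0)
    (hconv : ∀ α β ρ σ γ δ : Fin (d + 1), ∀ f : Vec d → ℝ,
      ContDiff ℝ (⊤ : ℕ∞) f → HasCompactSupport f → tsupport f ⊆ interior K →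
      ∀ m : Vec d → ℝ, Homog0 m →
      Tendsto (fun n => pairG g0
          (fun x => ((pd γ (fun y => χ y * (g n y α β - g0 y α β)) x : ℝ) : ℂ))
          (fun x => ((f x : ℝ) : ℂ) *
            Tm m (fun y => ((pd δ (fun z => χ z * (g n z ρ σ - g0 z ρ σ)) y : ℝ) : ℂ)) x))
        atTop (𝓝 ((sInt (μm α β ρ σ) (fun p => f p.1 * m p.2 * p.2 γ * p.2 δ) : ℝ) : ℂ)))
    :
    ∀ μ ν : Fin (d + 1), ∀ ψ : Vec d → ℝ,
      ContDiff ℝ (⊤ : ℕ∞) ψ → HasCompactSupport ψ → tsupport ψ ⊆ interior K →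
      (∫ x : Vec d, ψ x * RicciC g0 μ ν x * Real.sqrt |(g0 x).det|) =
        muInt g0 μm (fun p => ψ p.1 * p.2 μ * p.2 ν) := by
  have hO : IsOpen (interior K) := isOpen_interior
  have hOU : interior K ⊆ U := interior_subset.trans hKU
  have hmet : ∀ n, IsMetricOn (g n) (interior K) := fun n =>
    ⟨fun α β => ((hg n).1 α β).mono hOU, fun x hx => (hg n).2.1 x (hOU hx),
      fun x hx => (hg n).2.2 x (hOU hx)⟩
  have hdiff : ∀ n α β, ContDiffOn ℝ (⊤ : ℕ∞) (fun y => g n y α β - g0 y α β) U :=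
    fun n α β => ((hg n).1 α β).sub ((hg0.1 α β).mono (Set.subset_univ U))
  have hD : ∀ n a i j, ContDiffOn ℝ (⊤ : ℕ∞)
      (fun x => LimitingEinstein.dg (LimitingEinstein.hDiff g0 g n) x a i j) (interior K) :=
    fun n a i j => LimitingEinstein.contDiffOn_pd hO ((hdiff n i j).mono hOU) a
  obtain ⟨V, -, hKV, hχV⟩ := hχ4
  have hw := (LimitingEinstein.contDiff_volDensity hg0).continuous
  have hlim : ∀ i j k l a b f, ContDiff ℝ (⊤ : ℕ∞) f → HasCompactSupport f →
      tsupport f ⊆ interior K →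
      LimitingEinstein.IntLim (fun n x => f x * LimitingEinstein.volDensity g0 x *
        (LimitingEinstein.dg (LimitingEinstein.hDiff g0 g n) x a i j *
          LimitingEinstein.dg (LimitingEinstein.hDiff g0 g n) x b k l))
        (sInt (μm i j k l) (fun p => f p.1 * p.2 a * p.2 b)) := by
    intro i j k l a b f h1 h2 h3
    refine ⟨fun n => LimitingEinstein.integrable_mul_of_tsupport_subset hO
      (h1.continuous.mul hw) h2.mul_right
      ((closure_mono (Function.support_mul_subset_left _ _)).trans h3)
      ((hD n a i j).mul (hD n b k l)).continuousOn, ?_⟩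
    have h := hconv i j k l a b f h1 h2 h3 (fun _ => 1)
      ⟨contDiffOn_const, fun _ _ _ => rfl⟩
    simp only [mul_one] at h
    have h' := (Complex.continuous_re.tendsto _).comp h
    refine h'.congr fun n => ?_
    rw [Function.comp_apply, LimitingEinstein.pairG_Tm_one hUo hO g0 hχ1 hχ2 hχ3
      (fun x hx => hχV x (hKV (interior_subset hx))) (hdiff n k l) h3]
    rfl
  have H : LimitingEinstein.HighFrequency (interior K) g0 g lam (fun n => lam n ^ eta) C :=
    { isOpen := hO
      compact := hK.closure_of_subset interior_subset
      lam_pos := fun n => (hlam1 n).1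
      lam_le_one := fun n => (hlam1 n).2.le
      lam_tendsto := hlam3
      lam_le := fun n => by
        simpa using Real.rpow_le_rpow_of_exponent_ge (hlam1 n).1 (hlam1 n).2.le heta.2
      gauge_tendsto := by
        simpa only [Real.zero_rpow heta.1.ne'] using hlam3.rpow_const (Or.inr heta.1.le)
      limit := hg0
      metric := hmet
      ricci := fun n x hx => hric n x (hOU hx)
      bound_diff := fun n x hx => hb0 n x (hOU hx)
      bound_pd := fun n x hx => hb1 n x (hOU hx)
      bound_pd_pd := fun n x hx => hb2 n x (hOU hx)
      bound_gauge := fun n x hx => hb3 n x (hOU hx)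
      bound_pd_gauge := fun n x hx => hb4 n x (hOU hx)
      comm := fun a b i j k l => LimitingEinstein.weakNull_commD hg0 hD
        (fun f a b => by simp only [mul_right_comm]) (hlim i j k l) a b }
  intro μ ν ψ h1 h2 h3
  refine (H.integral_ricci hlim μ ν h1 h2 h3).trans ?_
  simp only [muInt, mul_assoc]

end
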